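/- arXiv:2106.00827 — 2 statements merged into one kernel-verified Lean document; each statement's English description precedes it below -/
import Mathlib

section
/- For every t > 0, the magnitude of the closed interval [0, t] ⊂ ℝ equals 1 + t/2, where Mag([0,t]) = sup{ 𝟙ᵀ ζ_Y⁻¹ 𝟙 : Y a finite subset of [0,t] } and ζ_Y(i,j) = exp(−|yᵢ − yⱼ|) for the points y₁, …, y_k of Y. -/
open Matrix

/-- The magnitude 𝟙ᵀ ζ_Y⁻¹ 𝟙 of a finite subset `Y` of a metric space, where
ζ_Y(i,j) = exp(−d(yᵢ,yⱼ)). -/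
noncomputable def finsetMagnitude {E : Type*} [MetricSpace E] (Y : Finset E) : ℝ :=
  letI : DecidableEq E := Classical.decEq E
  dotProduct (fun _ : ↥Y => (1 : ℝ))
    ((Matrix.of fun i j : ↥Y => Real.exp (-dist (i : E) (j : E)))⁻¹ *ᵥ
      fun _ : ↥Y => (1 : ℝ))

/-- The magnitude of an arbitrary subset `X` of a metric space, defined as the
supremum of the magnitudes of finite subsets of `X`. -/
noncomputable def setMagnitude {E : Type*} [MetricSpace E] (X : Set E) : ℝ :=
  sSup { r : ℝ | ∃ Y : Finset E, ↑Y ⊆ X ∧ r = finsetMagnitude Y }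

open Finset Filter Topology

theorem exists_solution_insert {s : Finset ℝ} {a m : ℝ} (hm : m ∈ s) (hmax : ∀ x ∈ s, x ≤ m)
    (ha : m < a) {w g : ℝ → ℝ} (hw : ∀ i ∈ s, ∑ j ∈ s, Real.exp (-dist i j) * w j = g i) :
    ∃ w' : ℝ → ℝ,
      (∀ i ∈ insert a s, ∑ j ∈ insert a s, Real.exp (-dist i j) * w' j = g i) ∧
      ∑ j ∈ insert a s, w' j =
        ∑ j ∈ s, w j + (g a - Real.exp (-(a - m)) * g m) / (1 + Real.exp (-(a - m))) := by
  have has : a ∉ s := fun h => (hmax a h).not_gt ha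
  set e := Real.exp (-(a - m)) with he
  have he0 : 0 < e := Real.exp_pos _
  have he1 : e < 1 := by rw [he, Real.exp_lt_one_iff]; linarith
  have h1 : 1 + e ≠ 0 := by positivity
  have h2 : 1 - e ≠ 0 := by linarith
  set c := (g a - e * g m) / ((1 + e) * (1 - e)) with hc
  have key (f : ℝ → ℝ) :
      ∑ j ∈ insert a s, f j * (if j = a then c else w j - if j = m then c * e else 0) =
        f a * c + (∑ j ∈ s, f j * w j - f m * (c * e)) := by
    rw [sum_insert has, if_pos rfl]
    congr 1
    rw [sum_congr rfl fun j hj => by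
      rw [if_neg (ne_of_mem_of_not_mem hj has), mul_sub, mul_ite, mul_zero]]
    rw [sum_sub_distrib, sum_ite_eq' s m, if_pos hm]
  refine ⟨fun j => if j = a then c else w j - if j = m then c * e else 0, ?_, ?_⟩
  · intro i hi
    rw [key fun j => Real.exp (-dist i j)]
    rcases mem_insert.1 hi with rfl | hi
    · have hrow : ∑ j ∈ s, Real.exp (-dist i j) * w j = e * g m := by
        rw [← hw m hm, mul_sum]
        refine sum_congr rfl fun j hj => ?_
        have hjm := hmax j hj
        rw [← mul_assoc, he, ← Real.exp_add, Real.dist_eq, Real.dist_eq,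
          abs_of_nonneg (by linarith), abs_of_nonneg (by linarith)]
        ring_nf
      have hd : Real.exp (-dist i m) = e := by rw [he, Real.dist_eq, abs_of_pos (by linarith)]
      rw [hrow, hd, dist_self, neg_zero, Real.exp_zero, hc]
      field_simp
      ring
    · have him := hmax i hi
      have hd : Real.exp (-dist i a) = Real.exp (-dist i m) * e := by
        rw [he, ← Real.exp_add, Real.dist_eq, Real.dist_eq, abs_of_nonpos (by linarith),
          abs_of_nonpos (by linarith)]
        ring_nf
      rw [hw i hi, hd]
      ring
  · have := key fun _ => 1
    simp only [one_mul] at this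
    rw [this, hc]
    field_simp
    ring

theorem exists_solution_exp_neg_dist (s : Finset ℝ) (g : ℝ → ℝ) :
    ∃ w : ℝ → ℝ, ∀ i ∈ s, ∑ j ∈ s, Real.exp (-dist i j) * w j = g i := by
  induction s using Finset.induction_on_max with
  | empty => simp
  | insert a s ha ih =>
    rcases s.eq_empty_or_nonempty with rfl | hs
    · exact ⟨g, by simp⟩
    · obtain ⟨w, hw⟩ := ih
      obtain ⟨w', hw', -⟩ := exists_solution_insert (s.max'_mem hs) (fun x hx => s.le_max' x hx)
        (ha _ (s.max'_mem hs)) hw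
      exact ⟨w', hw'⟩

theorem finsetMagnitude_eq_sum {s : Finset ℝ} {w : ℝ → ℝ}
    (hw : ∀ i ∈ s, ∑ j ∈ s, Real.exp (-dist i j) * w j = 1) :
    finsetMagnitude s = ∑ j ∈ s, w j := by
  let : DecidableEq ℝ := Classical.decEq ℝ
  set A : Matrix s s ℝ := Matrix.of fun i j : s => Real.exp (-dist (i : ℝ) (j : ℝ)) with hA
  have hmul (v : ℝ → ℝ) (i : s) :
      (A *ᵥ fun j : s => v j) i = ∑ j ∈ s, Real.exp (-dist (i : ℝ) j) * v j := by
    rw [← sum_coe_sort s]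
    rfl
  have hunit : IsUnit A := by
    rw [← mulVec_surjective_iff_isUnit]
    intro g
    obtain ⟨v, hv⟩ := exists_solution_exp_neg_dist s
      (fun x => if h : x ∈ s then g ⟨x, h⟩ else 0)
    refine ⟨fun j => v j, funext fun i => ?_⟩
    rw [hmul, hv i i.2, dif_pos i.2]
  have hA1 : A *ᵥ (fun j : s => w j) = fun _ => 1 := funext fun i => by rw [hmul, hw i i.2]
  change (fun _ : s => (1 : ℝ)) ⬝ᵥ (A⁻¹ *ᵥ fun _ => 1) = _
  rw [← hA1, mulVec_mulVec, nonsing_inv_mul A ((isUnit_iff_isUnit_det A).1 hunit), one_mulVec, hA1,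
    ← sum_coe_sort s]
  simp [dotProduct]

theorem finsetMagnitude_empty : finsetMagnitude (∅ : Finset ℝ) = 0 :=
  finsetMagnitude_eq_sum (w := 0) (by simp)

theorem finsetMagnitude_singleton (a : ℝ) : finsetMagnitude {a} = 1 := by
  rw [finsetMagnitude_eq_sum (w := 1) (by simp)]
  simp

theorem finsetMagnitude_insert {s : Finset ℝ} {a m : ℝ} (hm : m ∈ s) (hmax : ∀ x ∈ s, x ≤ m)
    (ha : m < a) :
    finsetMagnitude (insert a s) =
      finsetMagnitude s + (1 - Real.exp (-(a - m))) / (1 + Real.exp (-(a - m))) := by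
  obtain ⟨w, hw⟩ := exists_solution_exp_neg_dist s fun _ => 1
  obtain ⟨w', hw', hsum⟩ := exists_solution_insert hm hmax ha hw
  rw [finsetMagnitude_eq_sum hw, finsetMagnitude_eq_sum hw', hsum, mul_one]

theorem one_sub_exp_neg_div_le {d : ℝ} (hd : 0 ≤ d) :
    (1 - Real.exp (-d)) / (1 + Real.exp (-d)) ≤ d / 2 := by
  have h := Real.le_log_one_add_of_nonneg (sub_nonneg.2 (Real.one_le_exp hd))
  rw [add_sub_cancel, Real.log_exp] at h
  have hpos := Real.exp_pos d
  have heq : (1 - Real.exp (-d)) / (1 + Real.exp (-d)) =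
      2 * (Real.exp d - 1) / (Real.exp d - 1 + 2) / 2 := by
    have h' : Real.exp d - 1 + 2 ≠ 0 := by linarith
    rw [Real.exp_neg]
    field_simp
    ring
  rw [heq]
  linarith

theorem div_add_two_le_one_sub_exp_neg_div {d : ℝ} (hd : 0 ≤ d) :
    d / (d + 2) ≤ (1 - Real.exp (-d)) / (1 + Real.exp (-d)) := by
  have h := Real.add_one_le_exp d
  have h' : Real.exp (-d) * Real.exp d = 1 := by rw [← Real.exp_add]; simp
  have hpos := Real.exp_pos (-d)
  rw [div_le_div_iff₀ (by linarith) (by linarith)]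
  nlinarith

theorem finsetMagnitude_le {s : Finset ℝ} {b : ℝ} (hb : 0 ≤ b) (h0 : ∀ x ∈ s, 0 ≤ x)
    (hsb : ∀ x ∈ s, x ≤ b) : finsetMagnitude s ≤ 1 + b / 2 := by
  induction s using Finset.induction_on_max generalizing b with
  | empty => rw [finsetMagnitude_empty]; positivity
  | insert a s ha ih =>
    rcases s.eq_empty_or_nonempty with rfl | hs
    · rw [insert_empty_eq, finsetMagnitude_singleton]
      linarith
    · have hm := s.max'_mem hs
      have hma := ha _ hm
      have hle := ih (h0 _ (mem_insert_of_mem hm)) (fun x hx => h0 x (mem_insert_of_mem hx))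
        fun x hx => s.le_max' x hx
      have hgain := one_sub_exp_neg_div_le (sub_nonneg.2 hma.le)
      have hab := hsb a (mem_insert_self a s)
      rw [finsetMagnitude_insert hm (fun x hx => s.le_max' x hx) hma]
      linarith

theorem finsetMagnitude_image_mul {d : ℝ} (hd : 0 < d) (n : ℕ) :
    finsetMagnitude ((range (n + 1)).image fun k : ℕ => k * d) =
      1 + n * ((1 - Real.exp (-d)) / (1 + Real.exp (-d))) := by
  induction n with
  | zero => simp [finsetMagnitude_singleton]
  | succ n ih =>
    have hgap : ((n + 1 : ℕ) : ℝ) * d - n * d = d := by push_cast; ring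
    have hmax : ∀ x ∈ (range (n + 1)).image fun k : ℕ => k * d, x ≤ n * d := by
      intro x hx
      obtain ⟨k, hk, rfl⟩ := mem_image.1 hx
      have : (k : ℝ) ≤ n := by exact_mod_cast mem_range_succ_iff.1 hk
      gcongr
    rw [range_add_one, image_insert,
      finsetMagnitude_insert (mem_image.2 ⟨n, self_mem_range_succ n, rfl⟩) hmax (by linarith),
      ih, hgap]
    push_cast
    ring

/-- For every t > 0, the magnitude of the closed interval [0, t] ⊂ ℝ
equals 1 + t/2. -/
theorem magnitude_interval (t : ℝ) (ht : 0 < t) :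
    setMagnitude (Set.Icc (0 : ℝ) t) = 1 + t / 2 := by
  have hub : 1 + t / 2 ∈ upperBounds
      {r : ℝ | ∃ Y : Finset ℝ, ↑Y ⊆ Set.Icc (0 : ℝ) t ∧ r = finsetMagnitude Y} := by
    rintro _ ⟨Y, hY, rfl⟩
    exact finsetMagnitude_le ht.le (fun x hx => (hY hx).1) fun x hx => (hY hx).2
  refine le_antisymm (csSup_le ⟨_, ∅, by simp, rfl⟩ hub) ?_
  have hlim : Tendsto (fun n : ℕ => 1 + t / (t / (n + 1 : ℕ) + 2)) atTop (𝓝 (1 + t / (0 + 2))) :=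
    (tendsto_const_nhds.div
      (((tendsto_const_div_atTop_nhds_zero_nat t).comp (tendsto_add_atTop_nat 1)).add_const 2)
      (by norm_num)).const_add 1
  rw [zero_add] at hlim
  refine le_of_tendsto' hlim fun n => ?_
  have hd : 0 < t / (n + 1 : ℕ) := by positivity
  refine le_trans ?_ (le_csSup ⟨_, hub⟩
    ⟨(range (n + 1 + 1)).image fun k : ℕ => k * (t / (n + 1 : ℕ)), ?_, rfl⟩)
  · rw [finsetMagnitude_image_mul hd]
    have h := mul_le_mul_of_nonneg_left (div_add_two_le_one_sub_exp_neg_div hd.le)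
      (Nat.cast_nonneg (α := ℝ) (n + 1))
    rw [← mul_div_assoc, mul_div_cancel₀ t (by positivity)] at h
    linarith
  · intro x hx
    obtain ⟨k, hk, rfl⟩ := mem_image.1 (mem_coe.1 hx)
    have hk' : (k : ℝ) ≤ (n + 1 : ℕ) := by exact_mod_cast mem_range_succ_iff.1 hk
    refine ⟨by positivity, ?_⟩
    calc (k : ℝ) * (t / (n + 1 : ℕ)) ≤ (n + 1 : ℕ) * (t / (n + 1 : ℕ)) := by gcongr
      _ = t := by field_simp
end

section
/- For every nonnegative integer n, there exist real polynomials p and q with q(r) ≠ 0 for all r > 0 such that the magnitude of the closed ball of radius r in ℝ^{2n+1} equals p(r)/q(r) for every r > 0; that is, r ↦ Mag(B(0,r)) is a rational function of r, where Mag(B(0,r)) = sup{ 𝟙ᵀ ζ_Y⁻¹ 𝟙 : Y a finite subset of B(0,r) }. -/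
open Matrix

section Hilbert

variable {E H : Type*} [MetricSpace E] [NormedAddCommGroup H] [InnerProductSpace ℝ H]

/-- For a feature map of the kernel `exp (-dist x y)` with linearly independent values, the
magnitude of a finite set is the squared norm of an element of the span having inner product `1`
with every feature vector. -/
lemma exists_weighting_of_feature {φ : E → H}
    (hφ : ∀ x y, inner ℝ (φ x) (φ y) = Real.exp (-dist x y))
    (hli : LinearIndependent ℝ φ) (Y : Finset E) :
    ∃ v : Y → ℝ, (∀ y ∈ Y, inner ℝ (φ y) (∑ i, v i • φ i) = 1) ∧
      finsetMagnitude Y = ∑ i, v i := by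
  classical
  set M : Matrix Y Y ℝ := Matrix.of fun i j : Y => Real.exp (-dist (i : E) (j : E)) with hM
  have hinj : Function.Injective M.mulVec := by
    refine (injective_iff_map_eq_zero (Matrix.mulVecLin M)).2 fun v hv => ?_
    have hv' : ∀ i : Y, inner ℝ (φ i) (∑ j, v j • φ j) = 0 := by
      intro i
      have := congrFun hv i
      simpa [Matrix.mulVec, dotProduct, hM, inner_sum, inner_smul_right, hφ, mul_comm] using this
    have h0 : inner ℝ (∑ j, v j • φ j) (∑ j, v j • φ j) = 0 := by
      conv_lhs => rw [sum_inner]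
      exact Finset.sum_eq_zero fun i _ => by rw [real_inner_smul_left, hv', mul_zero]
    have h1 := inner_self_eq_zero.1 h0
    have hli' : LinearIndependent ℝ (fun i : Y => φ i) :=
      hli.comp _ Subtype.val_injective
    exact funext (Fintype.linearIndependent_iff.1 hli' v h1)
  have hunit : IsUnit M := Matrix.mulVec_injective_iff_isUnit.1 hinj
  have hdet : IsUnit M.det := (Matrix.isUnit_iff_isUnit_det M).1 hunit
  refine ⟨M⁻¹ *ᵥ fun _ => 1, ?_, ?_⟩
  · intro y hy
    have : (M *ᵥ (M⁻¹ *ᵥ fun _ => 1)) ⟨y, hy⟩ = 1 := by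
      rw [Matrix.mulVec_mulVec, Matrix.mul_nonsing_inv _ hdet, Matrix.one_mulVec]
    generalize (M⁻¹ *ᵥ fun _ => (1 : ℝ)) = v at *
    simpa [Matrix.mulVec, dotProduct, hM, inner_sum, inner_smul_right, hφ, mul_comm] using this
  · have hdec : (fun a b => Classical.propDecidable (a = b)) = Classical.decEq E :=
      Subsingleton.elim _ _
    simp only [finsetMagnitude, dotProduct, one_mul]
    refine Finset.sum_congr rfl fun i _ => ?_
    congr!

/-- If `h` lies in the closed span of the features of `X` and has inner product `1` with each of
them, then the magnitude of `X` is `‖h‖ ^ 2`. -/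
lemma setMagnitude_eq_norm_sq {φ : E → H}
    (hφ : ∀ x y, inner ℝ (φ x) (φ y) = Real.exp (-dist x y))
    (hli : LinearIndependent ℝ φ) {X : Set E} {h : H}
    (hone : ∀ x ∈ X, inner ℝ (φ x) h = 1)
    (hcl : h ∈ (Submodule.span ℝ (φ '' X)).topologicalClosure) :
    setMagnitude X = ‖h‖ ^ 2 := by
  classical
  have key : ∀ Y : Finset E, ↑Y ⊆ X → ∃ g : H, (∀ y ∈ Y, inner ℝ (φ y) g = 1) ∧
      finsetMagnitude Y = ‖g‖ ^ 2 ∧ inner ℝ g h = ‖g‖ ^ 2 := by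
    intro Y hY
    obtain ⟨v, hv, hm⟩ := exists_weighting_of_feature hφ hli Y
    have h1 : inner ℝ (∑ i, v i • φ i) (∑ i, v i • φ i) = ∑ i, v i := by
      conv_lhs => rw [sum_inner]
      exact Finset.sum_congr rfl fun i _ => by rw [real_inner_smul_left, hv i i.2, mul_one]
    have h2 : inner ℝ (∑ i, v i • φ i) h = ∑ i, v i := by
      rw [sum_inner]
      exact Finset.sum_congr rfl fun i _ => by
        rw [real_inner_smul_left, hone i (hY i.2), mul_one]
    rw [real_inner_self_eq_norm_sq] at h1
    exact ⟨_, hv, hm.trans h1.symm, h2.trans h1.symm⟩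
  refine csSup_eq_of_forall_le_of_forall_lt_exists_gt ⟨_, ∅, by simp, rfl⟩ ?_ ?_
  · rintro _ ⟨Y, hY, rfl⟩
    obtain ⟨g, -, hm, hg⟩ := key Y hY
    rw [hm]
    have h3 : 0 ≤ ‖h - g‖ ^ 2 := sq_nonneg _
    rw [norm_sub_sq_real, real_inner_comm, hg] at h3
    linarith
  · intro b hb
    obtain ⟨h', hh', hd⟩ := Metric.mem_closure_iff.1
      (by rwa [← Submodule.topologicalClosure_coe, SetLike.mem_coe] :
        h ∈ closure (Submodule.span ℝ (φ '' X) : Set H))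
      (√(‖h‖ ^ 2 - b)) (Real.sqrt_pos.2 (by linarith))
    obtain ⟨t, htX, a, ha⟩ := Submodule.mem_span_image_iff_exists_fun ℝ |>.1 hh'
    obtain ⟨g, hg1, hm, hg⟩ := key t htX
    refine ⟨_, ⟨t, htX, rfl⟩, ?_⟩
    rw [hm]
    have h4 : inner ℝ h' h = inner ℝ h' g := by
      rw [← ha, sum_inner, sum_inner]
      refine Finset.sum_congr rfl fun i _ => ?_
      rw [real_inner_smul_left, real_inner_smul_left, hone i (htX i.2), hg1 i i.2]
    have h5 : dist h h' ^ 2 < ‖h‖ ^ 2 - b := by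
      have := pow_lt_pow_left₀ hd dist_nonneg two_ne_zero
      rwa [Real.sq_sqrt (by linarith)] at this
    rw [dist_eq_norm, norm_sub_sq_real, real_inner_comm, h4] at h5
    have h6 : 0 ≤ ‖h' - g‖ ^ 2 := sq_nonneg _
    rw [norm_sub_sq_real] at h6
    linarith

end Hilbert

lemma linearIndependent_of_inner_eq_exp_neg_dist {E H : Type*} [NormedAddCommGroup E]
    [InnerProductSpace ℝ E] [Nontrivial E] [NormedAddCommGroup H] [InnerProductSpace ℝ H]
    {φ : E → H} (hφ : ∀ x y, inner ℝ (φ x) (φ y) = Real.exp (-dist x y)) :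
    LinearIndependent ℝ φ := by
  classical
  rw [linearIndependent_iff']
  intro s v hv i hi
  by_contra hne
  have h0 : ∀ x : E, v i * Real.exp (-‖x - i‖) =
      -∑ j ∈ s.erase i, v j * Real.exp (-‖x - j‖) := by
    intro x
    have h1 : inner ℝ (φ x) (∑ j ∈ s, v j • φ j) = 0 := by rw [hv, inner_zero_right]
    simp only [inner_sum, inner_smul_right, hφ, dist_eq_norm] at h1
    rw [← Finset.add_sum_erase _ _ hi] at h1
    linarith
  have hd : DifferentiableAt ℝ (fun x : E => v i * Real.exp (-‖x - i‖)) i := by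
    rw [funext h0]
    refine DifferentiableAt.neg (DifferentiableAt.fun_sum fun j hj => ?_)
    have hij : i - j ≠ 0 := sub_ne_zero.2 (Finset.ne_of_mem_erase hj).symm
    exact ((((differentiableAt_id.sub_const j).norm ℝ hij).neg).exp).const_mul _
  have hd2 : DifferentiableAt ℝ (fun x : E => Real.exp (-‖x - i‖)) i := by
    have := hd.const_mul (v i)⁻¹
    simpa [← mul_assoc, hne] using this
  have hd3 : DifferentiableAt ℝ (fun x : E => ‖x - i‖) i := by
    have := (hd2.log (Real.exp_ne_zero _)).neg
    simpa using this
  have hd4 : DifferentiableAt ℝ (fun x : E => ‖x‖) 0 := by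
    have h5 : DifferentiableAt ℝ (fun x : E => x + i) 0 := differentiableAt_id.add_const i
    have := DifferentiableAt.comp (f := fun x : E => x + i) (g := fun x : E => ‖x - i‖) 0
      (by simpa using hd3) h5
    simpa [Function.comp_def] using this
  exact not_differentiableAt_norm_zero E hd4

section OneDim

open Polynomial

/-- The linear functional `P ↦ ∫₀^∞ P(u) exp(-a u) du` on polynomials. -/
noncomputable def expInt (a : ℝ) : ℝ[X] →ₗ[ℝ] ℝ :=
  Polynomial.lsum fun k => ((k.factorial : ℝ) / a ^ (k + 1)) • LinearMap.id

lemma expInt_monomial (a : ℝ) (k : ℕ) (c : ℝ) :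
    expInt a (monomial k c) = k.factorial / a ^ (k + 1) * c := by
  simp [expInt, Polynomial.sum_monomial_index]

lemma expInt_X_pow (k : ℕ) : expInt 1 (X ^ k) = k.factorial := by
  rw [← monomial_one_right_eq_X_pow, expInt_monomial]; simp

lemma expInt_C_mul (a c : ℝ) (P : ℝ[X]) : expInt a (C c * P) = c * expInt a P := by
  rw [← smul_eq_C_mul, map_smul, smul_eq_mul]

lemma expInt_derivative {a : ℝ} (ha : a ≠ 0) (P : ℝ[X]) :
    expInt a (derivative P) = a * expInt a P - P.eval 0 := by
  induction P using Polynomial.induction_on' with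
  | add p q hp hq => simp only [map_add, hp, hq, eval_add]; ring
  | monomial k c =>
    rw [derivative_monomial, expInt_monomial, expInt_monomial]
    cases k with
    | zero => simp; field_simp; simp
    | succ k =>
      simp [Nat.factorial_succ]
      field_simp
      ring

lemma hasIntegral_exp_mul_monomial {a : ℝ} (ha : 0 < a) (k : ℕ) :
    MeasureTheory.IntegrableOn (fun u : ℝ => u ^ k * Real.exp (-(a * u))) (Set.Ioi 0) ∧
    ∫ u in Set.Ioi (0 : ℝ), u ^ k * Real.exp (-(a * u)) = k.factorial / a ^ (k + 1) := by
  constructor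
  · have := integrableOn_rpow_mul_exp_neg_mul_rpow (p := 1) (s := k) (b := a)
      (by have : (0 : ℝ) ≤ k := k.cast_nonneg
          linarith) one_pos ha
    simpa using this
  · have := Real.integral_rpow_mul_exp_neg_mul_Ioi (a := k + 1) (r := a) (by positivity) ha
    rw [Real.Gamma_nat_eq_factorial] at this
    simp only [add_sub_cancel_right, Real.rpow_natCast] at this
    rw [this, ← Nat.cast_succ, Real.rpow_natCast]
    simp [div_eq_mul_inv, mul_comm]

lemma integrableOn_eval_mul_exp {a : ℝ} (ha : 0 < a) (P : ℝ[X]) :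
    MeasureTheory.IntegrableOn (fun u : ℝ => P.eval u * Real.exp (-(a * u))) (Set.Ioi 0) := by
  induction P using Polynomial.induction_on' with
  | add p q hp hq => simp only [eval_add, add_mul]; exact hp.add hq
  | monomial k c =>
    simp only [eval_monomial, mul_assoc]
    exact (hasIntegral_exp_mul_monomial ha k).1.const_mul c

lemma integral_eval_mul_exp {a : ℝ} (ha : 0 < a) (P : ℝ[X]) :
    ∫ u in Set.Ioi (0 : ℝ), P.eval u * Real.exp (-(a * u)) = expInt a P := by
  induction P using Polynomial.induction_on' with
  | add p q hp hq =>
    simp only [eval_add, add_mul, map_add]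
    rw [MeasureTheory.integral_add (integrableOn_eval_mul_exp ha p)
      (integrableOn_eval_mul_exp ha q), hp, hq]
  | monomial k c =>
    simp only [eval_monomial, mul_assoc, MeasureTheory.integral_const_mul]
    rw [(hasIntegral_exp_mul_monomial ha k).2, expInt_monomial, mul_comm]

lemma hasDerivAt_expInt_mul_comp (a t : ℝ) (P Q : ℝ[X]) :
    HasDerivAt (fun t => expInt a (P * Q.comp (X + C t)))
      (expInt a (P * (derivative Q).comp (X + C t))) t := by
  induction Q using Polynomial.induction_on' with
  | add p q hp hq => simp only [add_comp, mul_add, map_add]; exact hp.add hq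
  | monomial k c =>
    have h : ∀ P : ℝ[X], HasDerivAt (fun t => expInt a (P * (X + C t) ^ k))
        (expInt a (P * (C (k : ℝ) * (X + C t) ^ (k - 1)))) t := by
      induction k with
      | zero => intro P; simpa using hasDerivAt_const t (expInt a P)
      | succ k ih =>
        intro P
        have h1 := (ih (P * X)).add ((hasDerivAt_id t).mul (ih P))
        refine (h1.congr_deriv ?_).congr_of_eventuallyEq
          (Filter.Eventually.of_forall fun s => ?_)
        · simp only [id, one_mul, ← expInt_C_mul, ← map_add]
          congr 1
          cases k with
          | zero => simp
          | succ k =>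
            simp only [Nat.add_sub_cancel, pow_succ, Nat.cast_succ, map_add, map_one]
            ring
        · simp only [id, Pi.add_apply, Pi.mul_apply, ← expInt_C_mul, ← map_add]
          congr 1
          ring
    have h1 := h (C c * P)
    refine (h1.congr_deriv ?_).congr_of_eventuallyEq (Filter.Eventually.of_forall fun s => ?_)
    · congr 1
      simp only [derivative_monomial, monomial_comp, map_mul]
      ring
    · simp only [monomial_comp]
      congr 1
      ring

/-- The Laguerre polynomials. -/
noncomputable def laguerrePoly : ℕ → ℝ[X]
  | 0 => 1
  | n + 1 => laguerrePoly n +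
      C (1 / ((n : ℝ) + 1)) * (X * (derivative (laguerrePoly n) - laguerrePoly n))

/-- The polynomials `A` for which the average over the unit sphere of `ℝ^(2n+1)` of
`A(|⟨x, θ⟩|) exp(-|⟨x, θ⟩|)` is `exp(-‖x‖)`. -/
noncomputable def kernelPoly : ℕ → ℝ[X]
  | 0 => 1
  | n + 1 => kernelPoly n +
      C (1 / (2 * (n : ℝ) + 1)) * (X * (derivative (kernelPoly n) - kernelPoly n))

lemma laguerrePoly_eval_zero (n : ℕ) : (laguerrePoly n).eval 0 = 1 := by
  induction n with
  | zero => simp [laguerrePoly]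
  | succ n ih => simp [laguerrePoly, ih]

lemma kernelPoly_eval_zero (n : ℕ) : (kernelPoly n).eval 0 = 1 := by
  induction n with
  | zero => simp [kernelPoly]
  | succ n ih => simp [kernelPoly, ih]

lemma natDegree_kernelPoly_le (n : ℕ) : (kernelPoly n).natDegree ≤ n := by
  induction n with
  | zero => simp [kernelPoly]
  | succ n ih =>
    refine (natDegree_add_le _ _).trans (max_le (ih.trans n.le_succ) ?_)
    refine (natDegree_C_mul_le _ _).trans (natDegree_mul_le.trans ?_)
    have h1 := natDegree_derivative_le (kernelPoly n)
    have h2 := natDegree_sub_le (derivative (kernelPoly n)) (kernelPoly n)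
    have h3 : (X : ℝ[X]).natDegree ≤ 1 := natDegree_X_le
    have h4 : max (derivative (kernelPoly n)).natDegree (kernelPoly n).natDegree ≤ n :=
      max_le (by omega) ih
    omega

lemma X_mul_derivative_laguerrePoly (n : ℕ) :
    X * (derivative (laguerrePoly n) - laguerrePoly n) =
      C ((n : ℝ) + 1) * (laguerrePoly (n + 1) - laguerrePoly n) := by
  have h : C ((n : ℝ) + 1) * C (1 / ((n : ℝ) + 1)) = 1 := by
    rw [← C_mul, mul_one_div_cancel (by positivity), C_1]
  rw [laguerrePoly, add_sub_cancel_left, ← mul_assoc, h, one_mul]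

lemma derivative_laguerrePoly_succ (n : ℕ) :
    derivative (laguerrePoly (n + 1)) = derivative (laguerrePoly n) - laguerrePoly n := by
  have hode : ∀ n, X * derivative (derivative (laguerrePoly n)) +
      (1 - X) * derivative (laguerrePoly n) + C (n : ℝ) * laguerrePoly n = 0 →
      derivative (laguerrePoly (n + 1)) = derivative (laguerrePoly n) - laguerrePoly n := by
    intro n h
    have hc : C ((n : ℝ) + 1) ≠ 0 := C_ne_zero.2 (by positivity)
    have h1 := congrArg derivative (X_mul_derivative_laguerrePoly n)
    simp only [derivative_mul, derivative_X, derivative_C, derivative_sub, zero_mul, zero_add]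
      at h1
    refine mul_left_cancel₀ hc ?_
    simp only [map_add, map_one] at h1 ⊢
    linear_combination h - h1
  have hall : ∀ n, X * derivative (derivative (laguerrePoly n)) +
      (1 - X) * derivative (laguerrePoly n) + C (n : ℝ) * laguerrePoly n = 0 := by
    intro n
    induction n with
    | zero => simp [laguerrePoly]
    | succ n ih =>
      have h1 := hode n ih
      have h2 := X_mul_derivative_laguerrePoly n
      rw [h1, derivative_sub]
      simp only [map_add, map_one, Nat.cast_succ] at h2 ⊢
      linear_combination ih - h2
  exact hode n (hall n)

/-- The autocorrelation at `0` of the Laguerre function `laguerrePoly n * exp (-u)`. -/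
noncomputable def laguerreNormSq : ℕ → ℝ
  | 0 => 1 / 2
  | n + 1 => laguerreNormSq n * ((2 * (n : ℝ) + 1) / (2 * n + 2))

lemma laguerreNormSq_pos (n : ℕ) : 0 < laguerreNormSq n := by
  induction n with
  | zero => norm_num [laguerreNormSq]
  | succ n ih => rw [laguerreNormSq]; positivity

lemma laguerre_autocorrelation (n : ℕ) (t : ℝ) :
    expInt 2 (laguerrePoly n * (laguerrePoly n).comp (X + C t)) =
      laguerreNormSq n * (kernelPoly n).eval t := by
  induction n generalizing t with
  | zero =>
    have := expInt_monomial 2 0 1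
    simpa [laguerrePoly, kernelPoly, laguerreNormSq] using this
  | succ n ih =>
    have hder : expInt 2 (laguerrePoly n * (derivative (laguerrePoly n)).comp (X + C t)) =
        laguerreNormSq n * (derivative (kernelPoly n)).eval t := by
      have h1 := hasDerivAt_expInt_mul_comp 2 t (laguerrePoly n) (laguerrePoly n)
      rw [funext ih] at h1
      exact h1.unique (((kernelPoly n).hasDerivAt t).const_mul _)
    have hN := derivative_laguerrePoly_succ n
    have hX := X_mul_derivative_laguerrePoly n
    have hP0 := laguerrePoly_eval_zero n
    have hN0 := laguerrePoly_eval_zero (n + 1)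
    have ih := ih t
    generalize hbn : laguerreNormSq n = b at *
    rw [kernelPoly, laguerreNormSq, hbn]
    generalize laguerrePoly (n + 1) = N at *
    generalize laguerrePoly n = P at *
    generalize kernelPoly n = A at *
    have hs : ∀ Q : ℝ[X], derivative (Q.comp (X + C t)) = (derivative Q).comp (X + C t) := by
      intro Q; simp [derivative_comp]
    have hXt := congrArg (fun Q : ℝ[X] => Q.comp (X + C t)) hX
    simp only [mul_comp, sub_comp, X_comp, C_comp] at hXt
    have e1 := expInt_derivative (a := 2) two_ne_zero (P * X * P.comp (X + C t))
    have e2 := expInt_derivative (a := 2) two_ne_zero ((P - N) * (P - N).comp (X + C t))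
    simp only [derivative_mul, hs, derivative_sub, derivative_X, hN, sub_comp] at e1 e2
    simp only [eval_mul, eval_sub, eval_X, hP0, hN0, mul_zero, zero_mul, sub_self, sub_zero]
      at e1 e2
    set P' := derivative P
    set SP := P.comp (X + C t)
    set SN := N.comp (X + C t)
    set SP' := P'.comp (X + C t)
    have f1 := congrArg (fun Q => expInt 2 (P * Q)) hXt
    have f2 := congrArg (fun Q => expInt 2 (Q * SP)) hX
    simp only [mul_sub, sub_mul, mul_add, add_mul, mul_one, map_sub, map_add, map_one]
      at e1 e2 f1 f2
    have c1 : ∀ (c : ℝ) (U V : ℝ[X]), expInt 2 (U * (C c * V)) = c * expInt 2 (U * V) := by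
      intro c U V; rw [← expInt_C_mul]; congr 1; ring
    have c2 : ∀ (c : ℝ) (U V : ℝ[X]), expInt 2 (C c * U * V) = c * expInt 2 (U * V) := by
      intro c U V; rw [← expInt_C_mul]; congr 1; ring
    have x1 : ∀ (U V : ℝ[X]), expInt 2 (U * (X * V)) = expInt 2 (X * U * V) := by
      intro U V; congr 1; ring
    have x2 : ∀ (U V : ℝ[X]), expInt 2 (U * X * V) = expInt 2 (X * U * V) := by
      intro U V; congr 1; ring
    simp only [c1, c2, x1, x2, one_mul] at e1 e2 f1 f2
    simp only [eval_add, eval_mul, eval_C, eval_X, eval_sub]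
    have hn1 : (n : ℝ) + 1 ≠ 0 := by positivity
    have hn2 : 2 * (n : ℝ) + 1 ≠ 0 := by positivity
    have hn3 : 2 * (n : ℝ) + 2 ≠ 0 := by positivity
    have hgoal : (2 * (n : ℝ) + 2) * expInt 2 (N * SN) =
        b * ((2 * n + 1) * eval t A + t * (eval t (derivative A) - eval t A)) := by
      linear_combination (-(n : ℝ) - 1) * e2 - f1 - f2 + e1 + t * hder + (2 * n + 1 - t) * ih
    field_simp
    linear_combination hgoal

lemma expInt_X_pow_mul_kernelPoly_succ (k n : ℕ) :
    expInt 1 (X ^ k * kernelPoly (n + 1)) =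
      (2 * n - k) / (2 * n + 1) * expInt 1 (X ^ k * kernelPoly n) := by
  have h := expInt_derivative (a := 1) one_ne_zero (X ^ (k + 1) * kernelPoly n)
  simp only [derivative_mul, derivative_X_pow, eval_mul, eval_pow, eval_X, Nat.add_sub_cancel,
    map_add, mul_assoc, expInt_C_mul] at h
  have h2 : expInt 1 (X ^ k * kernelPoly (n + 1)) = expInt 1 (X ^ k * kernelPoly n) +
      1 / (2 * (n : ℝ) + 1) * (expInt 1 (X ^ (k + 1) * derivative (kernelPoly n)) -
        expInt 1 (X ^ (k + 1) * kernelPoly n)) := by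
    rw [← map_sub, ← expInt_C_mul, ← map_add, kernelPoly]
    congr 1
    ring
  rw [h2]
  have hn2 : 2 * (n : ℝ) + 1 ≠ 0 := by positivity
  push_cast at h
  rw [zero_pow (by omega), zero_mul] at h
  field_simp
  linear_combination h

lemma expInt_X_pow_mul_kernelPoly (k n : ℕ) :
    expInt 1 (X ^ k * kernelPoly n) =
      k.factorial * ∏ i ∈ Finset.range n, ((2 * (i : ℝ) - k) / (2 * i + 1)) := by
  induction n with
  | zero => simp [kernelPoly, expInt_X_pow]
  | succ n ih => rw [expInt_X_pow_mul_kernelPoly_succ, ih, Finset.prod_range_succ]; ring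

lemma expInt_X_pow_mul_kernelPoly_eq_zero {j n : ℕ} (h : j < n) :
    expInt 1 (X ^ (2 * j) * kernelPoly n) = 0 := by
  rw [expInt_X_pow_mul_kernelPoly, Finset.prod_eq_zero (Finset.mem_range.2 h) (by simp), mul_zero]

/-- The one-dimensional kernel `A(t) exp(-t)`, to be evaluated at distances. -/
noncomputable def lineKernel (n : ℕ) (t : ℝ) : ℝ := (kernelPoly n).eval t * Real.exp (-t)

lemma continuous_lineKernel (n : ℕ) : Continuous (lineKernel n) := by
  unfold lineKernel; fun_prop

lemma lineKernel_zero (n : ℕ) : lineKernel n 0 = 1 := by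
  simp [lineKernel, kernelPoly_eval_zero]

/-- The Hardy operator `f ↦ (2 i + 1) ∫₀¹ τ^(2 i) f(s τ) dτ`. -/
noncomputable def hardyOp (i : ℕ) (f : ℝ → ℝ) (s : ℝ) : ℝ :=
  (2 * i + 1) * ∫ τ in (0 : ℝ)..1, τ ^ (2 * i) * f (s * τ)

lemma hardyOp_lineKernel (n : ℕ) : hardyOp n (lineKernel (n + 1)) = lineKernel n := by
  ext s
  have hd : ∀ τ ∈ Set.uIcc (0 : ℝ) 1, HasDerivAt (fun τ => τ ^ (2 * n + 1) * lineKernel n (s * τ))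
      ((2 * n + 1) * (τ ^ (2 * n) * lineKernel (n + 1) (s * τ))) τ := by
    intro τ _
    have h0 : HasDerivAt (fun τ : ℝ => s * τ) s τ := by
      simpa using (hasDerivAt_id τ).const_mul s
    have h1 : HasDerivAt (fun τ => (kernelPoly n).eval (s * τ))
        ((derivative (kernelPoly n)).eval (s * τ) * s) τ :=
      ((kernelPoly n).hasDerivAt (s * τ)).comp τ h0
    have h2 := (hasDerivAt_pow (2 * n + 1) τ).mul (h1.mul h0.neg.exp)
    refine h2.congr_deriv ?_
    simp only [lineKernel, kernelPoly, Pi.mul_apply, Pi.neg_apply, eval_add, eval_mul, eval_C,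
      eval_X, eval_sub]
    have hn2 : 2 * (n : ℝ) + 1 ≠ 0 := by positivity
    push_cast
    field_simp
    ring
  have hc := continuous_lineKernel (n + 1)
  have := intervalIntegral.integral_eq_sub_of_hasDerivAt hd
    (Continuous.intervalIntegrable (by fun_prop) _ _)
  rw [hardyOp, ← intervalIntegral.integral_const_mul, this]
  simp

end OneDim

section Sphere

open MeasureTheory Set Polynomial

lemma continuous_hardyOp (i : ℕ) {f : ℝ → ℝ} (hf : Continuous f) : Continuous (hardyOp i f) := by
  unfold hardyOp
  refine continuous_const.mul
    (intervalIntegral.continuous_parametric_intervalIntegral_of_continuous' ?_ 0 1)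
  fun_prop

lemma hardyOp_add (i : ℕ) {f g : ℝ → ℝ} (hf : Continuous f) (hg : Continuous g) :
    hardyOp i (fun s => f s + g s) = fun s => hardyOp i f s + hardyOp i g s := by
  ext s
  simp only [hardyOp, mul_add]
  rw [intervalIntegral.integral_add (Continuous.intervalIntegrable (by fun_prop) _ _)
    (Continuous.intervalIntegrable (by fun_prop) _ _), mul_add]

lemma hardyOp_const_mul_pow (i k : ℕ) (c : ℝ) :
    hardyOp i (fun s => c * s ^ k) = fun s => c * ((2 * i + 1) / (k + 2 * i + 1)) * s ^ k := by
  ext s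
  have h : ∀ τ : ℝ, τ ^ (2 * i) * (c * (s * τ) ^ k) = c * s ^ k * τ ^ (2 * i + k) := by
    intro τ; rw [mul_pow, pow_add]; ring
  simp only [hardyOp, h, intervalIntegral.integral_const_mul, integral_pow]
  have h2 : (k : ℝ) + 2 * i + 1 ≠ 0 := by positivity
  have h3 : 2 * (i : ℝ) + k + 1 ≠ 0 := by positivity
  simp
  field_simp
  ring

lemma abs_hardyOp_sub_le (i : ℕ) {f g : ℝ → ℝ} (hf : Continuous f) (hg : Continuous g)
    {R ε : ℝ} (h : ∀ s ∈ Icc 0 R, |f s - g s| ≤ ε) :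
    ∀ s ∈ Icc 0 R, |hardyOp i f s - hardyOp i g s| ≤ ε := by
  intro s hs
  rw [hardyOp, hardyOp, ← mul_sub, ← intervalIntegral.integral_sub
    (Continuous.intervalIntegrable (by fun_prop) _ _)
    (Continuous.intervalIntegrable (by fun_prop) _ _), abs_mul]
  have h1 : |∫ τ in (0 : ℝ)..1, (τ ^ (2 * i) * f (s * τ) - τ ^ (2 * i) * g (s * τ))| ≤
      ∫ τ in (0 : ℝ)..1, τ ^ (2 * i) * ε := by
    rw [← Real.norm_eq_abs]
    refine intervalIntegral.norm_integral_le_of_norm_le zero_le_one ?_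
      (Continuous.intervalIntegrable (by fun_prop) _ _)
    refine Filter.Eventually.of_forall fun τ hτ => ?_
    rw [← mul_sub, norm_mul, norm_pow, Real.norm_of_nonneg hτ.1.le]
    refine mul_le_mul_of_nonneg_left (h _ ⟨mul_nonneg hs.1 hτ.1.le, ?_⟩) (pow_nonneg hτ.1.le _)
    nlinarith [hs.1, hs.2, hτ.2]
  rw [intervalIntegral.integral_mul_const, integral_pow] at h1
  have h2 : (0 : ℝ) < 2 * i + 1 := by positivity
  rw [abs_of_pos h2]
  calc _ ≤ (2 * (i : ℝ) + 1) * _ := mul_le_mul_of_nonneg_left h1 h2.le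
    _ = ε := by simp; field_simp

lemma eq_zero_of_hardyOp_eq_zero (i : ℕ) {f : ℝ → ℝ} (hf : Continuous f) {r : ℝ} (hr : 0 < r)
    (h : ∀ s ∈ Icc 0 r, hardyOp i f s = 0) : ∀ s ∈ Icc 0 r, f s = 0 := by
  have hI : ∀ s ∈ Ioo 0 r, ∫ t in (0 : ℝ)..s, t ^ (2 * i) * f t = 0 := by
    intro s hs
    have h1 := h s ⟨hs.1.le, hs.2.le⟩
    rw [hardyOp, mul_eq_zero, or_iff_right (by positivity)] at h1
    have h2 := intervalIntegral.integral_comp_mul_left (a := 0) (b := 1)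
      (fun t => t ^ (2 * i) * f t) hs.1.ne'
    simp only [mul_pow, mul_assoc, intervalIntegral.integral_const_mul, h1, mul_zero, mul_one]
      at h2
    have := smul_eq_zero.1 h2.symm
    exact this.resolve_left (inv_ne_zero hs.1.ne')
  have hoo : ∀ s ∈ Ioo 0 r, f s = 0 := by
    intro s hs
    have hd : HasDerivAt (fun s => ∫ t in (0 : ℝ)..s, t ^ (2 * i) * f t) (s ^ (2 * i) * f s) s :=
      Continuous.integral_hasStrictDerivAt (f := fun t => t ^ (2 * i) * f t) (by fun_prop) 0 s
        |>.hasDerivAt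
    have h0 : HasDerivAt (fun s => ∫ t in (0 : ℝ)..s, t ^ (2 * i) * f t) 0 s := by
      refine (hasDerivAt_const s (0 : ℝ)).congr_of_eventuallyEq ?_
      filter_upwards [Ioo_mem_nhds hs.1 hs.2] with t ht using hI t ht
    exact (mul_eq_zero.1 (hd.unique h0)).resolve_left (pow_ne_zero _ hs.1.ne')
  intro s hs
  have hcl : IsClosed {s | f s = 0} := isClosed_eq hf continuous_const
  have := closure_minimal (fun s hs => hoo s hs : Ioo 0 r ⊆ {s | f s = 0}) hcl
  rw [closure_Ioo hr.ne] at this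
  exact this hs

/-- The operator taking `f` to `ρ ↦ ∫ f(|⟨x, θ⟩|) dσ(θ)`, where `‖x‖ = ρ` and `σ` is the uniform
probability measure on the unit sphere of `ℝ^(2n+1)`, written as a composition of Hardy
operators. -/
noncomputable def radialAvg : ℕ → (ℝ → ℝ) → ℝ → ℝ
  | 0, f => f
  | n + 1, f => radialAvg n (hardyOp n f)

lemma radialAvg_lineKernel (n : ℕ) : radialAvg n (lineKernel n) = fun s => Real.exp (-s) := by
  induction n with
  | zero => ext s; simp [radialAvg, lineKernel, kernelPoly]
  | succ n ih => rw [radialAvg, hardyOp_lineKernel, ih]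

lemma radialAvg_add (n : ℕ) {f g : ℝ → ℝ} (hf : Continuous f) (hg : Continuous g) :
    radialAvg n (fun s => f s + g s) = fun s => radialAvg n f s + radialAvg n g s := by
  induction n generalizing f g with
  | zero => rfl
  | succ n ih =>
    rw [radialAvg, hardyOp_add n hf hg, ih (continuous_hardyOp n hf) (continuous_hardyOp n hg)]
    rfl

lemma radialAvg_const_mul_pow (n k : ℕ) (c : ℝ) :
    radialAvg n (fun s => c * s ^ k) = fun s =>
      c * (∏ i ∈ Finset.range n, ((2 * (i : ℝ) + 1) / (k + 2 * i + 1))) * s ^ k := by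
  induction n generalizing c with
  | zero => ext s; simp [radialAvg]
  | succ n ih =>
    rw [radialAvg, hardyOp_const_mul_pow, ih, Finset.prod_range_succ]
    ext s
    ring

lemma abs_radialAvg_sub_le (n : ℕ) {f g : ℝ → ℝ} (hf : Continuous f) (hg : Continuous g)
    {R ε : ℝ} (h : ∀ s ∈ Icc 0 R, |f s - g s| ≤ ε) :
    ∀ s ∈ Icc 0 R, |radialAvg n f s - radialAvg n g s| ≤ ε := by
  induction n generalizing f g with
  | zero => exact h
  | succ n ih =>
    exact ih (continuous_hardyOp n hf) (continuous_hardyOp n hg) (abs_hardyOp_sub_le n hf hg h)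

lemma eq_zero_of_radialAvg_eq_zero (n : ℕ) {f : ℝ → ℝ} (hf : Continuous f) {r : ℝ} (hr : 0 < r)
    (h : ∀ s ∈ Icc 0 r, radialAvg n f s = 0) : ∀ s ∈ Icc 0 r, f s = 0 := by
  induction n generalizing f with
  | zero => exact h
  | succ n ih => exact eq_zero_of_hardyOp_eq_zero n hf hr (ih (continuous_hardyOp n hf) h)

/-- Polar coordinates for a function that is a product of a function of the direction and a
function of the norm. -/
lemma integral_polar_mul {E : Type*} [NormedAddCommGroup E] [NormedSpace ℝ E]
    [FiniteDimensional ℝ E] [Nontrivial E] [MeasurableSpace E] [BorelSpace E] (μ : Measure E)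
    [μ.IsAddHaarMeasure] (F : E → ℝ) (a : Metric.sphere (0 : E) 1 → ℝ) (b : ℝ → ℝ)
    (hF : ∀ (θ : Metric.sphere (0 : E) 1) (ρ : ℝ), 0 < ρ → F (ρ • (θ : E)) = a θ * b ρ) :
    ∫ y, F y ∂μ = (∫ θ, a θ ∂μ.toSphere) *
      ∫ ρ in Ioi (0 : ℝ), ρ ^ (Module.finrank ℝ E - 1) * b ρ := by
  have hF' : ∀ y : ({0}ᶜ : Set E), F y = a (homeomorphUnitSphereProd E y).1 *
      b (homeomorphUnitSphereProd E y).2 := by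
    intro y
    rw [← hF _ _ (homeomorphUnitSphereProd E y).2.2]
    congr 1
    exact (congrArg Subtype.val ((homeomorphUnitSphereProd E).symm_apply_apply y)).symm
  calc
    ∫ y, F y ∂μ = ∫ y : ({0}ᶜ : Set E), F y ∂(μ.comap (↑)) := by
      rw [integral_subtype_comap (measurableSet_singleton _).compl F, restrict_compl_singleton]
    _ = ∫ z : Metric.sphere (0 : E) 1 × Ioi (0 : ℝ), a z.1 * b z.2
          ∂μ.toSphere.prod (.volumeIoiPow (Module.finrank ℝ E - 1)) := by
      simp only [hF']
      exact μ.measurePreserving_homeomorphUnitSphereProd.integral_comp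
        (Homeomorph.measurableEmbedding _)
          fun z : Metric.sphere (0 : E) 1 × Ioi (0 : ℝ) => a z.1 * b z.2
    _ = (∫ θ, a θ ∂μ.toSphere) *
        ∫ ρ : Ioi (0 : ℝ), b ρ ∂.volumeIoiPow (Module.finrank ℝ E - 1) :=
      integral_prod_mul (f := a) (g := fun ρ : Ioi (0 : ℝ) => b ρ)
    _ = _ := by
      congr 1
      simp only [Measure.volumeIoiPow, ENNReal.ofReal]
      rw [integral_withDensity_eq_integral_smul,
        integral_subtype_comap measurableSet_Ioi
          fun a ↦ Real.toNNReal (a ^ (Module.finrank ℝ E - 1)) • b a,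
        setIntegral_congr_fun measurableSet_Ioi fun x hx ↦ ?_]
      · simp only [NNReal.smul_def, Real.coe_toNNReal _ (pow_nonneg (mem_Ioi.1 hx).le _),
            smul_eq_mul]
      · exact (measurable_subtype_coe.pow_const _).real_toNNReal

lemma integral_abs_pow_mul_exp_neg_sq (k : ℕ) :
    ∫ t : ℝ, |t| ^ k * Real.exp (-t ^ 2) = Real.Gamma ((k + 1) / 2) := by
  have h := integral_comp_abs (f := fun t : ℝ => t ^ k * Real.exp (-t ^ 2))
  simp only [sq_abs] at h
  have h2 := integral_rpow_mul_exp_neg_rpow (p := 2) (q := k) two_pos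
    (by have : (0 : ℝ) ≤ k := k.cast_nonneg
        linarith)
  simp only [Real.rpow_natCast, Real.rpow_two] at h2
  rw [h, h2]
  ring

lemma gamma_add_nat (a : ℝ) (ha : 0 < a) (n : ℕ) :
    Real.Gamma (a + n) = Real.Gamma a * ∏ i ∈ Finset.range n, (a + i) := by
  induction n with
  | zero => simp
  | succ n ih =>
    rw [Nat.cast_succ, ← add_assoc, Real.Gamma_add_one (by positivity), ih,
      Finset.prod_range_succ]
    ring

/-- Rotating so that `x` points along the first coordinate axis. -/
lemma integral_abs_inner_pow_mul_exp (n k : ℕ) (x : EuclideanSpace ℝ (Fin (2 * n + 1))) :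
    ∫ y : EuclideanSpace ℝ (Fin (2 * n + 1)), |inner ℝ x y| ^ k * Real.exp (-‖y‖ ^ 2) =
      ‖x‖ ^ k * (Real.Gamma ((k + 1) / 2) * √Real.pi ^ (2 * n)) := by
  set e : EuclideanSpace ℝ (Fin (2 * n + 1)) := EuclideanSpace.single 0 ‖x‖ with he
  have hxe : ‖e‖ = ‖x‖ := by simp [he]
  set U := Submodule.reflection (ℝ ∙ (e - x))ᗮ
  have hU : U e = x := Submodule.reflection_sub hxe
  have h1 := U.measurePreserving.integral_comp U.toHomeomorph.measurableEmbedding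
    (fun y => |inner ℝ x y| ^ k * Real.exp (-‖y‖ ^ 2))
  rw [← h1]
  have h2 : ∀ y, |inner ℝ x (U y)| ^ k * Real.exp (-‖U y‖ ^ 2) =
      ‖x‖ ^ k * ∏ i, Fin.cons (α := fun _ => ℝ → ℝ) (fun t : ℝ => |t| ^ k * Real.exp (-t ^ 2))
        (fun _ t => Real.exp (-t ^ 2)) i (y.ofLp i) := by
    intro y
    conv_lhs => rw [← hU, U.inner_map_map, U.norm_map, EuclideanSpace.norm_sq_eq]
    simp only [he, EuclideanSpace.inner_single_left, Fin.prod_univ_succ, Fin.sum_univ_succ,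
      Fin.cons_zero, Fin.cons_succ, ← Real.exp_sum, abs_mul, mul_pow, neg_add, Real.exp_add,
      Real.norm_eq_abs, sq_abs, Finset.sum_neg_distrib]
    simp
    ring
  simp only [h2, integral_const_mul]
  congr 1
  have h3 := (PiLp.volume_preserving_ofLp (Fin (2 * n + 1))).integral_comp
    (MeasurableEquiv.toLp 2 (Fin (2 * n + 1) → ℝ)).symm.measurableEmbedding
    (fun z : Fin (2 * n + 1) → ℝ => ∏ i, Fin.cons (α := fun _ => ℝ → ℝ)
      (fun t : ℝ => |t| ^ k * Real.exp (-t ^ 2)) (fun _ t => Real.exp (-t ^ 2)) i (z i))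
  rw [h3, integral_fintype_prod_volume_eq_prod, Fin.prod_univ_succ]
  simp only [Fin.cons_zero, Fin.cons_succ, integral_abs_pow_mul_exp_neg_sq]
  have h4 := integral_gaussian 1
  simp only [neg_mul, one_mul, div_one] at h4
  simp [h4]

lemma integral_toSphere_abs_inner_pow (n k : ℕ) (x : EuclideanSpace ℝ (Fin (2 * n + 1))) :
    (∫ θ, |inner ℝ x (θ : EuclideanSpace ℝ (Fin (2 * n + 1)))| ^ k
      ∂(volume : Measure (EuclideanSpace ℝ (Fin (2 * n + 1)))).toSphere) *
      ∏ i ∈ Finset.range n, (((k : ℝ) + 1) / 2 + i) = ‖x‖ ^ k * (2 * √Real.pi ^ (2 * n)) := by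
  have h1 := integral_polar_mul (volume : Measure (EuclideanSpace ℝ (Fin (2 * n + 1))))
    (fun y => |inner ℝ x y| ^ k * Real.exp (-‖y‖ ^ 2))
    (fun θ => |inner ℝ x (θ : EuclideanSpace ℝ (Fin (2 * n + 1)))| ^ k)
    (fun ρ => ρ ^ k * Real.exp (-ρ ^ 2)) (by
      intro θ ρ hρ
      rw [inner_smul_right, norm_smul, norm_eq_of_mem_sphere, Real.norm_of_nonneg hρ.le, abs_mul,
        abs_of_pos hρ, mul_pow, mul_one]
      ring)
  rw [integral_abs_inner_pow_mul_exp] at h1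
  simp only [finrank_euclideanSpace, Fintype.card_fin, Nat.add_sub_cancel, ← mul_assoc,
    ← pow_add] at h1
  have h2 := integral_rpow_mul_exp_neg_rpow (p := 2) (q := ((2 * n + k : ℕ) : ℝ)) two_pos
    (by have : (0 : ℝ) ≤ ((2 * n + k : ℕ) : ℝ) := Nat.cast_nonneg _
        linarith)
  simp only [Real.rpow_natCast, Real.rpow_two] at h2
  have h3 := gamma_add_nat (((k : ℝ) + 1) / 2) (by positivity) n
  have h4 : (((2 * n + k : ℕ) : ℝ) + 1) / 2 = ((k : ℝ) + 1) / 2 + n := by push_cast; ring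
  rw [h2, h4, h3] at h1
  have h5 : Real.Gamma (((k : ℝ) + 1) / 2) ≠ 0 := (Real.Gamma_pos_of_pos (by positivity)).ne'
  apply mul_left_cancel₀ h5
  linear_combination (-2) * h1

/-- The uniform probability measure on the unit sphere of `ℝ^(2n+1)`. -/
noncomputable def sphereProb (n : ℕ) :
    Measure (Metric.sphere (0 : EuclideanSpace ℝ (Fin (2 * n + 1))) 1) :=
  ((volume : Measure (EuclideanSpace ℝ (Fin (2 * n + 1)))).toSphere univ)⁻¹ •
    (volume : Measure (EuclideanSpace ℝ (Fin (2 * n + 1)))).toSphere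

instance (n : ℕ) : IsProbabilityMeasure (sphereProb n) := by
  have : NeZero ((volume : Measure (EuclideanSpace ℝ (Fin (2 * n + 1)))).toSphere) :=
    ⟨Measure.toSphere_ne_zero _⟩
  unfold sphereProb
  infer_instance

lemma integral_sphereProb_abs_inner_pow (n k : ℕ) (x : EuclideanSpace ℝ (Fin (2 * n + 1))) :
    ∫ θ, |inner ℝ x (θ : EuclideanSpace ℝ (Fin (2 * n + 1)))| ^ k ∂sphereProb n =
      (∏ i ∈ Finset.range n, ((2 * (i : ℝ) + 1) / (k + 2 * i + 1))) * ‖x‖ ^ k := by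
  have hk := integral_toSphere_abs_inner_pow n k x
  have h0 := integral_toSphere_abs_inner_pow n 0 x
  simp only [pow_zero, integral_const, smul_eq_mul, mul_one, one_mul, Nat.cast_zero, zero_add]
    at h0
  rw [sphereProb, integral_smul_measure, ENNReal.toReal_inv, smul_eq_mul, ← measureReal_def]
  have hp1 : 0 < ∏ i ∈ Finset.range n, (((k : ℝ) + 1) / 2 + i) :=
    Finset.prod_pos fun i _ => by positivity
  have hp2 : 0 < ∏ i ∈ Finset.range n, ((1 : ℝ) / 2 + i) :=
    Finset.prod_pos fun i _ => by positivity
  have hp3 : ∏ i ∈ Finset.range n, ((2 * (i : ℝ) + 1) / (k + 2 * i + 1)) =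
      (∏ i ∈ Finset.range n, ((1 : ℝ) / 2 + i)) /
        ∏ i ∈ Finset.range n, (((k : ℝ) + 1) / 2 + i) := by
    rw [← Finset.prod_div_distrib]
    refine Finset.prod_congr rfl fun i _ => ?_
    have h2 : (k : ℝ) + 2 * i + 1 ≠ 0 := by positivity
    have h3 : ((k : ℝ) + 1) / 2 + i ≠ 0 := by positivity
    field_simp
    ring
  rw [hp3]
  generalize ∏ i ∈ Finset.range n, (((k : ℝ) + 1) / 2 + i) = p1 at *
  generalize ∏ i ∈ Finset.range n, ((1 : ℝ) / 2 + i) = p2 at *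
  generalize Measure.real _ _ = m at *
  have hm : m ≠ 0 := by
    rintro rfl
    have : 0 < √Real.pi := Real.sqrt_pos.2 Real.pi_pos
    have : (0 : ℝ) < 2 * √Real.pi ^ (2 * n) := by positivity
    linarith
  field_simp
  rw [hk, ← h0]
  ring

lemma integral_sphereProb_eq_radialAvg (n : ℕ) {f : ℝ → ℝ} (hf : Continuous f)
    (x : EuclideanSpace ℝ (Fin (2 * n + 1))) :
    ∫ θ, f |inner ℝ x (θ : EuclideanSpace ℝ (Fin (2 * n + 1)))| ∂sphereProb n =
      radialAvg n f ‖x‖ := by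
  have hint : ∀ {g : ℝ → ℝ}, Continuous g → Integrable
      (fun θ : Metric.sphere (0 : EuclideanSpace ℝ (Fin (2 * n + 1))) 1 =>
        g |inner ℝ x (θ : EuclideanSpace ℝ (Fin (2 * n + 1)))|) (sphereProb n) := by
    intro g hg
    refine Continuous.integrable_of_hasCompactSupport (by fun_prop)
      (HasCompactSupport.of_compactSpace _)
  have hP : ∀ P : ℝ[X], ∫ θ, P.eval |inner ℝ x (θ : EuclideanSpace ℝ (Fin (2 * n + 1)))|
      ∂sphereProb n = radialAvg n (fun t => P.eval t) ‖x‖ := by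
    intro P
    induction P using Polynomial.induction_on' with
    | add p q hp hq =>
      simp only [eval_add]
      rw [integral_add (hint p.continuous) (hint q.continuous), hp, hq,
        radialAvg_add n p.continuous q.continuous]
    | monomial k c =>
      simp only [eval_monomial]
      rw [integral_const_mul, integral_sphereProb_abs_inner_pow, radialAvg_const_mul_pow]
      ring
  refine eq_of_forall_dist_le fun ε hε => ?_
  rw [Real.dist_eq]
  obtain ⟨P, hPf⟩ := exists_polynomial_near_of_continuousOn 0 ‖x‖ f hf.continuousOn (ε / 2)
    (half_pos hε)
  have h1 := abs_radialAvg_sub_le n (R := ‖x‖) P.continuous hf (fun s hs => (hPf s hs).le) ‖x‖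
    ⟨norm_nonneg _, le_rfl⟩
  have h2 : |∫ θ, f |inner ℝ x (θ : EuclideanSpace ℝ (Fin (2 * n + 1)))| ∂sphereProb n -
      ∫ θ, P.eval |inner ℝ x (θ : EuclideanSpace ℝ (Fin (2 * n + 1)))| ∂sphereProb n| ≤ ε / 2 := by
    rw [← integral_sub (hint hf) (hint P.continuous), ← Real.norm_eq_abs]
    refine (norm_integral_le_of_norm_le_const (C := ε / 2)
      (Filter.Eventually.of_forall fun θ => ?_)).trans (by simp)
    rw [Real.norm_eq_abs, abs_sub_comm]
    refine (hPf _ ⟨abs_nonneg _, ?_⟩).le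
    have := abs_real_inner_le_norm x (θ : EuclideanSpace ℝ (Fin (2 * n + 1)))
    rwa [norm_eq_of_mem_sphere, mul_one] at this
  rw [hP] at h2
  have := abs_sub_le (∫ θ, f |inner ℝ x (θ : EuclideanSpace ℝ (Fin (2 * n + 1)))| ∂sphereProb n)
    (radialAvg n (fun t => P.eval t) ‖x‖) (radialAvg n f ‖x‖)
  linarith

end Sphere

section Feature

open MeasureTheory Set Polynomial

/-- The Laguerre function `L(u) exp(-u)` on the positive half-line, extended by zero. -/
noncomputable def laguerreFun (n : ℕ) : ℝ → ℝ :=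
  (Ioi (0 : ℝ)).indicator fun u => (laguerrePoly n).eval u * Real.exp (-u)

lemma measurable_laguerreFun (n : ℕ) : Measurable (laguerreFun n) :=
  Measurable.indicator (by fun_prop) measurableSet_Ioi

lemma memLp_laguerreFun (n : ℕ) : MemLp (laguerreFun n) 2 := by
  rw [memLp_two_iff_integrable_sq (measurable_laguerreFun n).aestronglyMeasurable]
  have h := integrableOn_eval_mul_exp (a := 2) two_pos (laguerrePoly n * laguerrePoly n)
  rw [← integrable_indicator_iff measurableSet_Ioi] at h
  refine h.congr (Filter.Eventually.of_forall fun u => ?_)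
  by_cases hu : u ∈ Ioi (0 : ℝ)
  · simp only [laguerreFun, indicator_of_mem hu, eval_mul]
    rw [mul_pow, ← Real.exp_nat_mul]
    push_cast
    ring_nf
  · simp [laguerreFun, indicator_of_notMem hu]

lemma integral_laguerreFun_mul (n : ℕ) (t s : ℝ) :
    ∫ u, laguerreFun n (u - t) * laguerreFun n (u - s) =
      laguerreNormSq n * lineKernel n |t - s| := by
  wlog hst : s ≤ t generalizing t s
  · rw [abs_sub_comm, ← this s t (le_of_not_ge hst)]
    simp only [mul_comm]
  rw [abs_of_nonneg (sub_nonneg.2 hst)]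
  have h1 := integral_sub_right_eq_self (μ := volume)
    (fun u => laguerreFun n u * laguerreFun n (u + (t - s))) t
  have h2 : ∀ u : ℝ, u - t + (t - s) = u - s := fun u => by ring
  simp only [h2] at h1
  rw [h1, lineKernel, ← mul_assoc, ← laguerre_autocorrelation, ← integral_eval_mul_exp two_pos,
    ← integral_mul_const, ← integral_indicator measurableSet_Ioi]
  refine integral_congr_ae (Filter.Eventually.of_forall fun u => ?_)
  by_cases hu : u ∈ Ioi (0 : ℝ)
  · have hu' : u + (t - s) ∈ Ioi (0 : ℝ) := by
      simp only [mem_Ioi] at hu ⊢; linarith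
    simp only [laguerreFun, indicator_of_mem hu, indicator_of_mem hu', eval_mul, eval_comp,
      eval_add, eval_X, eval_C]
    have : Real.exp (-(u + (t - s))) = Real.exp (-u) * Real.exp (-(t - s)) := by
      rw [← Real.exp_add]; ring_nf
    have h3 : Real.exp (-(2 * u)) = Real.exp (-u) * Real.exp (-u) := by
      rw [← Real.exp_add]; ring_nf
    rw [this, h3]
    ring
  · simp [laguerreFun, indicator_of_notMem hu]

/-- A feature map on the line for the kernel `lineKernel n`. -/
noncomputable def lineFeature (n : ℕ) (t : ℝ) : Lp ℝ 2 (volume : Measure ℝ) :=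
  (√(laguerreNormSq n))⁻¹ •
    ((memLp_laguerreFun n).comp_measurePreserving (measurePreserving_sub_right volume t)).toLp

lemma inner_lineFeature (n : ℕ) (t s : ℝ) :
    inner ℝ (lineFeature n t) (lineFeature n s) = lineKernel n |t - s| := by
  have hb := laguerreNormSq_pos n
  rw [lineFeature, lineFeature, real_inner_smul_left, real_inner_smul_right, L2.inner_def,
    integral_congr_ae (g := fun u => laguerreFun n (u - t) * laguerreFun n (u - s)),
    integral_laguerreFun_mul, ← mul_assoc, ← mul_assoc, ← mul_inv, Real.mul_self_sqrt hb.le,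
    inv_mul_cancel₀ hb.ne', one_mul]
  filter_upwards [MemLp.coeFn_toLp ((memLp_laguerreFun n).comp_measurePreserving
    (measurePreserving_sub_right volume t)), MemLp.coeFn_toLp
    ((memLp_laguerreFun n).comp_measurePreserving (measurePreserving_sub_right volume s))]
    with u hu hv
  rw [hu, hv]
  simp [mul_comm]

lemma continuous_lineFeature (n : ℕ) : Continuous (lineFeature n) := by
  rw [Metric.continuous_iff']
  intro t ε hε
  have h1 : Continuous fun s => 2 - 2 * lineKernel n |s - t| := by
    have := continuous_lineKernel n
    fun_prop
  have h2 := (h1.tendsto t).eventually_lt_const (u := ε ^ 2)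
    (by simp [lineKernel_zero]; positivity)
  filter_upwards [h2] with s hs
  rw [dist_eq_norm]
  refine lt_of_pow_lt_pow_left₀ 2 hε.le (lt_of_eq_of_lt ?_ hs)
  rw [norm_sub_sq_real, ← real_inner_self_eq_norm_sq, ← real_inner_self_eq_norm_sq,
    inner_lineFeature, inner_lineFeature, inner_lineFeature]
  simp [lineKernel_zero]
  ring

/-- The primitive of the Laguerre function that vanishes at the origin. -/
noncomputable def laguerrePrim (n : ℕ) (y : ℝ) : ℝ := ∫ u in (0 : ℝ)..y, laguerreFun n u

lemma intervalIntegrable_laguerreFun (n : ℕ) (a b : ℝ) :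
    IntervalIntegrable (laguerreFun n) volume a b :=
  (((memLp_laguerreFun n).locallyIntegrable (by norm_num)).integrableOn_isCompact
    isCompact_uIcc).intervalIntegrable

lemma continuous_laguerrePrim (n : ℕ) : Continuous (laguerrePrim n) :=
  intervalIntegral.continuous_primitive (intervalIntegrable_laguerreFun n) 0

lemma laguerrePrim_of_nonpos (n : ℕ) {y : ℝ} (hy : y ≤ 0) : laguerrePrim n y = 0 := by
  refine intervalIntegral.integral_zero_ae (Filter.Eventually.of_forall fun u hu => ?_)
  rw [uIoc_of_ge hy] at hu
  exact indicator_of_notMem (by simpa using hu.2) _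

lemma exists_laguerrePrim_bounds (n : ℕ) :
    ∃ δ > 0, ∀ y, 0 ≤ y → y < δ → y / 2 ≤ laguerrePrim n y ∧ laguerrePrim n y ≤ 2 * y := by
  have hc : Continuous fun u => (laguerrePoly n).eval u * Real.exp (-u) := by fun_prop
  have h1 := (hc.tendsto 0).eventually (Ioo_mem_nhds (a := 1 / 2) (b := 2)
    (by simp [laguerrePoly_eval_zero]; norm_num) (by simp [laguerrePoly_eval_zero]))
  obtain ⟨δ, hδ, h⟩ := Metric.eventually_nhds_iff.1 h1
  refine ⟨δ, hδ, fun y hy hyδ => ?_⟩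
  have hb : ∀ u ∈ Ioo 0 y, laguerreFun n u ∈ Ioo (1 / 2 : ℝ) 2 := by
    intro u hu
    rw [laguerreFun, indicator_of_mem (mem_Ioi.2 hu.1)]
    refine h ?_
    rw [Real.dist_eq, sub_zero, abs_of_pos hu.1]
    exact hu.2.trans hyδ
  have e1 := intervalIntegral.integral_mono_on_of_le_Ioo hy
    (intervalIntegrable_const (c := (1 / 2 : ℝ))) (intervalIntegrable_laguerreFun n 0 y)
    fun u hu => (hb u hu).1.le
  have e2 := intervalIntegral.integral_mono_on_of_le_Ioo hy
    (intervalIntegrable_laguerreFun n 0 y) (intervalIntegrable_const (c := (2 : ℝ)))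
    fun u hu => (hb u hu).2.le
  simp only [intervalIntegral.integral_const, sub_zero, smul_eq_mul] at e1 e2
  exact ⟨by rw [laguerrePrim]; linarith, by rw [laguerrePrim]; linarith⟩

/-- Testing the feature map against indicators of intervals. -/
lemma inner_indicator_lineFeature (n : ℕ) {a x t : ℝ} (hat : a ≤ t) (hax : a ≤ x) :
    inner ℝ (indicatorConstLp 2 (measurableSet_Ioc (a := a) (b := x))
      (measure_Ioc_lt_top (μ := volume)).ne (1 : ℝ)) (lineFeature n t) =
      (√(laguerreNormSq n))⁻¹ * laguerrePrim n (x - t) := by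
  rw [lineFeature, real_inner_smul_right, L2.inner_indicatorConstLp_one]
  congr 1
  have h1 : ∫ u in Ioc a x, ((((memLp_laguerreFun n).comp_measurePreserving
      (measurePreserving_sub_right volume t)).toLp : Lp ℝ 2 (volume : Measure ℝ)) : ℝ → ℝ) u =
      ∫ u in Ioc a x, laguerreFun n (u - t) :=
    setIntegral_congr_ae measurableSet_Ioc ((MemLp.coeFn_toLp _).mono fun u hu _ => hu)
  rw [h1, ← intervalIntegral.integral_of_le hax, intervalIntegral.integral_comp_sub_right,
    ← intervalIntegral.integral_add_adjacent_intervals (b := 0)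
      (intervalIntegrable_laguerreFun n _ _) (intervalIntegrable_laguerreFun n _ _),
    intervalIntegral.integral_symm]
  have h2 := laguerrePrim_of_nonpos n (sub_nonpos.2 hat)
  rw [laguerrePrim] at h2
  rw [h2, neg_zero, zero_add, laguerrePrim]

end Feature

section LineWeight

open MeasureTheory Set Polynomial

lemma comp_X_add_C_eq_sum_hasseDeriv {P : ℝ[X]} {N : ℕ} (hP : P.natDegree ≤ N) (y : ℝ) :
    P.comp (X + C y) = ∑ j ∈ Finset.range (N + 1), C (y ^ j) * hasseDeriv j P := by
  refine Polynomial.funext fun x => ?_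
  have h1 : (P.comp (X + C y)).eval x = (taylor x P).eval y := by
    simp [taylor_eval, add_comm]
  rw [h1, eval_eq_sum_range' (n := N + 1) (by rw [natDegree_taylor]; omega), eval_finsetSum]
  refine Finset.sum_congr rfl fun j _ => ?_
  rw [taylor_coeff]
  simp [mul_comm]

lemma expInt_mul_kernelPoly_of_even {n : ℕ} {P : ℝ[X]} (hP : P.natDegree ≤ 2 * n)
    (hev : P.comp (-X) = P) :
    expInt 1 (P * kernelPoly n) = P.coeff (2 * n) * expInt 1 (X ^ (2 * n) * kernelPoly n) := by
  have hodd : ∀ k, Odd k → P.coeff k = 0 := by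
    intro k hk
    have := congrArg (fun Q => Q.coeff k) hev
    have hX : (-X : ℝ[X]) = C (-1) * X := by simp
    simp only [hX, comp_C_mul_X_coeff, hk.neg_one_pow] at this
    linarith
  conv_lhs => rw [P.as_sum_range_C_mul_X_pow' (n := 2 * n + 1) (by omega)]
  simp only [Finset.sum_mul, map_sum, mul_assoc, expInt_C_mul]
  rw [Finset.sum_range_succ, Finset.sum_eq_zero, zero_add]
  intro k hk
  rcases Nat.even_or_odd' k with ⟨j, rfl | rfl⟩
  · rw [expInt_X_pow_mul_kernelPoly_eq_zero (by have := Finset.mem_range.1 hk; omega), mul_zero]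
  · rw [hodd _ (odd_two_mul_add_one j), zero_mul]

lemma coeff_comp_X_add_C_of_natDegree_le {P : ℝ[X]} {N : ℕ} (hP : P.natDegree ≤ N) (y : ℝ) :
    (P.comp (X + C y)).coeff N = P.coeff N := by
  have h : hasseDeriv N P = C (P.coeff N) := by
    ext k
    rw [hasseDeriv_coeff, coeff_C]
    split_ifs with hk
    · simp [hk]
    · rw [coeff_eq_zero_of_natDegree_lt (by omega), mul_zero]
  rw [← taylor_apply, taylor_coeff, h, eval_C]

lemma expInt_symmetrized {n : ℕ} {W : ℝ[X]} (hdeg : W.natDegree ≤ 2 * n)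
    (hev : ∀ x, W.eval (-x) = W.eval x) (t : ℝ) :
    expInt 1 ((W.comp (X + C t) + W.comp (X + C (-t))) * kernelPoly n) =
      2 * expInt 1 (X ^ (2 * n) * kernelPoly n) * W.coeff (2 * n) := by
  have hd : ∀ y, (W.comp (X + C y)).natDegree ≤ 2 * n := by
    intro y; rwa [← taylor_apply, natDegree_taylor]
  rw [expInt_mul_kernelPoly_of_even ((natDegree_add_le _ _).trans (max_le (hd t) (hd (-t)))),
    coeff_add, coeff_comp_X_add_C_of_natDegree_le hdeg, coeff_comp_X_add_C_of_natDegree_le hdeg]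
  · ring
  · refine Polynomial.funext fun x => ?_
    simp only [add_comp, eval_add, eval_comp, eval_X, eval_C, eval_neg]
    rw [← hev (-x + t), ← hev (-x + -t)]
    ring_nf

lemma integral_Ioi_eval_mul_lineKernel {n : ℕ} (P : ℝ[X]) (y : ℝ) :
    ∫ x in Ioi (0 : ℝ), P.eval x * lineKernel n (y + x) =
      Real.exp (-y) * expInt 1 (P * (kernelPoly n).comp (X + C y)) := by
  rw [← integral_eval_mul_exp one_pos, ← integral_const_mul]
  refine integral_congr_ae (Filter.Eventually.of_forall fun x => ?_)
  simp only [lineKernel, eval_mul, eval_comp, eval_add, eval_X, eval_C, neg_add, Real.exp_add,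
    one_mul, add_comm x y]
  ring

lemma integrableOn_Ioi_eval_mul_lineKernel (n : ℕ) (P : ℝ[X]) :
    IntegrableOn (fun x => P.eval x * lineKernel n x) (Ioi 0) := by
  refine (integrableOn_eval_mul_exp one_pos (P * kernelPoly n)).congr_fun (fun x _ => ?_)
    measurableSet_Ioi
  simp [lineKernel, mul_assoc]

lemma intervalIntegral_eval_mul_lineKernel (n : ℕ) (P : ℝ[X]) {a : ℝ} (ha : 0 ≤ a) :
    ∫ x in (0 : ℝ)..a, P.eval x * lineKernel n x = expInt 1 (P * kernelPoly n) -
      Real.exp (-a) * expInt 1 (P.comp (X + C a) * (kernelPoly n).comp (X + C a)) := by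
  have h0 := integrableOn_Ioi_eval_mul_lineKernel n P
  have h1 := intervalIntegral.integral_Ioi_sub_Ioi h0 ha
  have h2 := integral_Ioi_eval_mul_lineKernel (n := n) P 0
  have h3 := integral_Ioi_eval_mul_lineKernel (n := n) (P.comp (X + C a)) a
  have h4 := (measurePreserving_add_right volume a).setIntegral_preimage_emb
    (MeasurableEquiv.addRight a).measurableEmbedding (fun x => P.eval x * lineKernel n x) (Ioi a)
  simp only [preimage_add_const_Ioi, sub_self, zero_add, neg_zero, Real.exp_zero, one_mul,
    C_0, add_zero, comp_X] at h2 h4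
  simp only [eval_comp, eval_add, eval_X, eval_C, add_comm a] at h3
  rw [← h1, h2, ← h4, h3]

/-- The weighting of `[-r, r]` with density `w` and an atom of mass `c` at both end points, as an
element of the feature space. -/
noncomputable def lineWeight (n : ℕ) (r : ℝ) (w : ℝ → ℝ) (c : ℝ) : Lp ℝ 2 (volume : Measure ℝ) :=
  (∫ s in -r..r, w s • lineFeature n s) + c • (lineFeature n r + lineFeature n (-r))

lemma inner_lineWeight (n : ℕ) (r c : ℝ) {w : ℝ → ℝ} (hw : Continuous w)
    (v : Lp ℝ 2 (volume : Measure ℝ)) :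
    inner ℝ v (lineWeight n r w c) = (∫ s in -r..r, w s * inner ℝ v (lineFeature n s)) +
      c * (inner ℝ v (lineFeature n r) + inner ℝ v (lineFeature n (-r))) := by
  have hi : IntervalIntegrable (fun s => w s • lineFeature n s) volume (-r) r :=
    (hw.smul (continuous_lineFeature n)).intervalIntegrable _ _
  have h1 := (innerSL ℝ v).intervalIntegral_comp_comm hi
  simp only [innerSL_apply_apply, real_inner_smul_right] at h1
  rw [lineWeight, inner_add_right, real_inner_smul_right, inner_add_right, h1]

lemma norm_sq_lineWeight (n : ℕ) {r : ℝ} (hr : 0 ≤ r) (c b : ℝ) {w : ℝ → ℝ} (hw : Continuous w)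
    (h : ∀ t ∈ Icc (-r) r, inner ℝ (lineFeature n t) (lineWeight n r w c) = b) :
    ‖lineWeight n r w c‖ ^ 2 = ((∫ s in -r..r, w s) + 2 * c) * b := by
  rw [← real_inner_self_eq_norm_sq, inner_lineWeight n r c hw]
  simp only [real_inner_comm _ (lineWeight n r w c)]
  rw [h r ⟨by linarith, le_rfl⟩, h (-r) ⟨le_rfl, by linarith⟩,
    intervalIntegral.integral_congr (g := fun s => w s * b),
    intervalIntegral.integral_mul_const]
  · ring
  · intro s hs
    rw [uIcc_of_le (by linarith)] at hs
    simp only [h s hs]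

/-- The weighting condition on `[-r, r]` in terms of finitely many linear equations. -/
lemma inner_lineFeature_lineWeight {n : ℕ} {r c : ℝ} {W : ℝ[X]} (hdeg : W.natDegree ≤ 2 * n)
    (hev : ∀ x, W.eval (-x) = W.eval x)
    (hW : ∀ j ≤ n, expInt 1 (W.comp (X + C r) * hasseDeriv j (kernelPoly n)) =
      c * (hasseDeriv j (kernelPoly n)).eval 0) {t : ℝ} (ht : t ∈ Icc (-r) r) :
    inner ℝ (lineFeature n t) (lineWeight n r (fun s => W.eval s) c) =
      2 * expInt 1 (X ^ (2 * n) * kernelPoly n) * W.coeff (2 * n) := by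
  have htail : ∀ y, Real.exp (-y) *
      expInt 1 (W.comp (X + C r) * (kernelPoly n).comp (X + C y)) = c * lineKernel n y := by
    intro y
    have h0 : (kernelPoly n).eval y = ((kernelPoly n).comp (X + C y)).eval 0 := by simp
    rw [lineKernel, h0, comp_X_add_C_eq_sum_hasseDeriv (natDegree_kernelPoly_le n)]
    simp only [Finset.mul_sum, map_sum, eval_finsetSum, eval_mul, eval_C]
    rw [Finset.sum_mul, Finset.mul_sum]
    refine Finset.sum_congr rfl fun j hj => ?_
    rw [mul_left_comm, expInt_C_mul, hW j (by have := Finset.mem_range.1 hj; omega)]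
    ring
  have hcomp : ∀ a b : ℝ, (W.comp (X + C a)).comp (X + C b) = W.comp (X + C (b + a)) := by
    intro a b
    refine Polynomial.funext fun x => ?_
    simp [add_assoc]
  have hneg : ∀ Q : ℝ[X], W.comp (-Q) = W.comp Q := by
    intro Q
    refine Polynomial.funext fun x => ?_
    simp [hev]
  have hcont := continuous_lineKernel n
  have hint : ∀ a b : ℝ, IntervalIntegrable (fun s => W.eval s * lineKernel n |t - s|) volume a b :=
    fun a b => Continuous.intervalIntegrable (by fun_prop) _ _
  have hleft : ∫ s in -r..t, W.eval s * lineKernel n |t - s| =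
      expInt 1 (W.comp (X + C (-t)) * kernelPoly n) - c * lineKernel n (t + r) := by
    have h1 := intervalIntegral.integral_comp_sub_left
      (fun x => (W.comp (X + C (-t))).eval x * lineKernel n x) t (a := -r) (b := t)
    rw [sub_self, sub_neg_eq_add, intervalIntegral_eval_mul_lineKernel n _ (by linarith [ht.1]),
      hcomp, add_neg_cancel_comm, htail] at h1
    rw [← h1]
    refine intervalIntegral.integral_congr fun s hs => ?_
    rw [uIcc_of_le ht.1] at hs
    simp only [abs_of_nonneg (sub_nonneg.2 hs.2), eval_comp, eval_add, eval_X, eval_C]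
    rw [← hev s]
    ring_nf
  have hright : ∫ s in t..r, W.eval s * lineKernel n |t - s| =
      expInt 1 (W.comp (X + C t) * kernelPoly n) - c * lineKernel n (r - t) := by
    have h1 := intervalIntegral.integral_comp_sub_right
      (fun x => (W.comp (X + C t)).eval x * lineKernel n x) t (a := t) (b := r)
    rw [sub_self, intervalIntegral_eval_mul_lineKernel n _ (by linarith [ht.2]),
      hcomp, sub_add_cancel, htail] at h1
    rw [← h1]
    refine intervalIntegral.integral_congr fun s hs => ?_
    rw [uIcc_of_le ht.2] at hs
    simp only [abs_sub_comm t s, abs_of_nonneg (sub_nonneg.2 hs.1), eval_comp, eval_add, eval_X,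
      eval_C, sub_add_cancel]
  rw [inner_lineWeight n r c W.continuous, ← expInt_symmetrized hdeg hev t]
  simp only [inner_lineFeature]
  rw [← intervalIntegral.integral_add_adjacent_intervals (hint (-r) t) (hint t r), hleft, hright,
    abs_sub_comm t r, abs_of_nonneg (sub_nonneg.2 ht.2), sub_neg_eq_add,
    abs_of_nonneg (by linarith [ht.1] : 0 ≤ t + r), add_mul, map_add]
  ring

end LineWeight

section Rational

open MeasureTheory Set Polynomial

lemma exists_sign_right_of_ne_zero {W : ℝ[X]} (hW : W ≠ 0) (a : ℝ) :
    ∃ ε > 0, (∀ s ∈ Ioo a (a + ε), 0 < W.eval s) ∨ ∀ s ∈ Ioo a (a + ε), W.eval s < 0 := by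
  obtain ⟨V, hV, hdvd⟩ := exists_eq_pow_rootMultiplicity_mul_and_not_dvd W hW a
  have hVa : V.eval a ≠ 0 := fun h => hdvd (dvd_iff_isRoot.2 h)
  have heval : ∀ s, W.eval s = (s - a) ^ W.rootMultiplicity a * V.eval s := by
    intro s
    conv_lhs => rw [hV]
    simp
  rcases lt_or_gt_of_ne hVa with h | h
  · obtain ⟨ε, hε, hs⟩ := Metric.eventually_nhds_iff.1
      ((V.continuous.tendsto a).eventually_lt_const h)
    refine ⟨ε, hε, Or.inr fun s hsa => ?_⟩
    rw [heval]
    refine mul_neg_of_pos_of_neg (pow_pos (sub_pos.2 hsa.1) _) (hs ?_)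
    rw [Real.dist_eq, abs_of_pos (sub_pos.2 hsa.1)]
    linarith [hsa.2]
  · obtain ⟨ε, hε, hs⟩ := Metric.eventually_nhds_iff.1
      ((V.continuous.tendsto a).eventually_const_lt h)
    refine ⟨ε, hε, Or.inl fun s hsa => ?_⟩
    rw [heval]
    refine mul_pos (pow_pos (sub_pos.2 hsa.1) _) (hs ?_)
    rw [Real.dist_eq, abs_of_pos (sub_pos.2 hsa.1)]
    linarith [hsa.2]

lemma laguerrePrim_convolution_eq_zero {n : ℕ} {r c : ℝ} {w : ℝ → ℝ} (hw : Continuous w)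
    (h : lineWeight n r w c = 0) {y : ℝ} (hy : 0 ≤ y) (hyr : y ≤ 2 * r) :
    c * laguerrePrim n y + ∫ s in -r..-r + y, w s * laguerrePrim n (-r + y - s) = 0 := by
  have h1 := inner_lineWeight n r c hw (indicatorConstLp 2
    (measurableSet_Ioc (a := -r) (b := -r + y)) (measure_Ioc_lt_top (μ := volume)).ne (1 : ℝ))
  have hcont := continuous_laguerrePrim n
  have hi : ∀ a b, IntervalIntegrable (fun s => w s * laguerrePrim n (-r + y - s)) volume a b :=
    fun a b => Continuous.intervalIntegrable (by fun_prop) _ _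
  have h2 : ∫ s in -r + y..r, w s * laguerrePrim n (-r + y - s) = 0 := by
    refine intervalIntegral.integral_zero_ae (Filter.Eventually.of_forall fun s hs => ?_)
    rw [uIoc_of_le (by linarith)] at hs
    rw [laguerrePrim_of_nonpos n (by linarith [hs.1]), mul_zero]
  have h3 : ∫ s in -r..r, w s * inner ℝ (indicatorConstLp 2
      (measurableSet_Ioc (a := -r) (b := -r + y)) (measure_Ioc_lt_top (μ := volume)).ne (1 : ℝ))
      (lineFeature n s) =
      (√(laguerreNormSq n))⁻¹ * ∫ s in -r..r, w s * laguerrePrim n (-r + y - s) := by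
    rw [← intervalIntegral.integral_const_mul]
    refine intervalIntegral.integral_congr fun s hs => ?_
    rw [uIcc_of_le (by linarith)] at hs
    rw [inner_indicator_lineFeature n hs.1 (by linarith)]
    ring
  rw [h, inner_zero_right, h3, ← intervalIntegral.integral_add_adjacent_intervals (hi _ _) (hi _ _),
    h2, inner_indicator_lineFeature n (by linarith) (by linarith),
    inner_indicator_lineFeature n le_rfl (by linarith), laguerrePrim_of_nonpos n
    (by linarith : -r + y - r ≤ 0)] at h1
  have hb : (√(laguerreNormSq n))⁻¹ ≠ 0 :=
    inv_ne_zero (Real.sqrt_ne_zero'.2 (laguerreNormSq_pos n))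
  refine (mul_eq_zero.1 (?_ : (√(laguerreNormSq n))⁻¹ * _ = 0)).resolve_left hb
  rw [show -r + y - -r = y by ring] at h1
  linear_combination -h1

lemma eq_zero_of_lineWeight_eq_zero {n : ℕ} {r c : ℝ} (hr : 0 < r) {W : ℝ[X]}
    (h : lineWeight n r (fun s => W.eval s) c = 0) : W = 0 ∧ c = 0 := by
  have hconv := fun y => laguerrePrim_convolution_eq_zero (y := y) W.continuous h
  obtain ⟨δ, hδ, hΨ⟩ := exists_laguerrePrim_bounds n
  have hcont := continuous_laguerrePrim n
  have hc : c = 0 := by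
    by_contra hc
    obtain ⟨B, hB⟩ := isCompact_Icc.exists_bound_of_continuousOn (s := Icc (-r) r)
      W.continuous.continuousOn
    have hB0 : 0 ≤ B := (norm_nonneg _).trans (hB r ⟨by linarith, le_rfl⟩)
    have hcB : 0 < |c| / (4 * B + 1) := by positivity
    obtain ⟨y, hy0, hy⟩ := exists_between (lt_min hcB (lt_min hδ (by linarith : 0 < 2 * r)))
    rw [lt_min_iff, lt_min_iff, lt_div_iff₀ (by positivity)] at hy
    obtain ⟨hyc, hyδ, hyr⟩ := hy
    have h1 := hconv y hy0.le hyr.le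
    have h2 := intervalIntegral.norm_integral_le_of_norm_le_const (a := -r) (b := -r + y)
      (f := fun s => W.eval s * laguerrePrim n (-r + y - s)) (C := B * (2 * y)) (fun s hs => by
        rw [uIoc_of_le (by linarith)] at hs
        have h3 := hΨ (-r + y - s) (by linarith [hs.2]) (by linarith [hs.1])
        rw [norm_mul]
        refine mul_le_mul (hB s ⟨hs.1.le, by linarith [hs.2]⟩) ?_ (norm_nonneg _) hB0
        rw [Real.norm_eq_abs, abs_of_nonneg (by linarith [hs.2])]
        linarith [hs.1])
    rw [eq_neg_of_add_eq_zero_right h1, norm_neg, norm_mul, Real.norm_eq_abs, Real.norm_eq_abs,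
      add_sub_cancel_left, abs_of_pos hy0] at h2
    have h3 := (hΨ y hy0.le hyδ).1
    rw [abs_of_nonneg (by linarith : 0 ≤ laguerrePrim n y)] at h2
    have h4 : |c| * (y / 2) ≤ |c| * laguerrePrim n y :=
      mul_le_mul_of_nonneg_left h3 (abs_nonneg c)
    nlinarith
  refine ⟨?_, hc⟩
  by_contra hW
  obtain ⟨ε, hε, hs⟩ := exists_sign_right_of_ne_zero hW (-r)
  obtain ⟨y, hy0, hy⟩ := exists_between (lt_min hε (lt_min hδ (by linarith : 0 < 2 * r)))
  rw [lt_min_iff, lt_min_iff] at hy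
  obtain ⟨hyε, hyδ, hyr⟩ := hy
  have h1 := hconv y hy0.le hyr.le
  rw [hc, zero_mul, zero_add] at h1
  have hpos : ∀ s ∈ Ioo (-r) (-r + y), 0 < laguerrePrim n (-r + y - s) := by
    intro s hs
    have := (hΨ (-r + y - s) (by linarith [hs.2]) (by linarith [hs.1])).1
    linarith [hs.2]
  have hmem : ∀ s ∈ Ioo (-r) (-r + y), s ∈ Ioo (-r) (-r + ε) := fun s hs =>
    ⟨hs.1, hs.2.trans (by linarith)⟩
  rcases hs with hs | hs
  · exact (intervalIntegral.intervalIntegral_pos_of_pos_on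
      (Continuous.intervalIntegrable (by fun_prop) _ _)
      (fun s hs' => mul_pos (hs s (hmem s hs')) (hpos s hs')) (by linarith)).ne' h1
  · have h2 := intervalIntegral.intervalIntegral_pos_of_pos_on (a := -r) (b := -r + y)
      (f := fun s => -(W.eval s * laguerrePrim n (-r + y - s)))
      (Continuous.intervalIntegrable (by fun_prop) _ _)
      (fun s hs' => neg_pos.2 (mul_neg_of_neg_of_pos (hs s (hmem s hs')) (hpos s hs')))
      (by linarith)
    rw [intervalIntegral.integral_neg, h1, neg_zero] at h2
    exact h2.false

/-- The even polynomial with prescribed coefficients in even degrees. -/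
noncomputable def evenPoly {n : ℕ} (w : Fin (n + 1) → ℝ) : ℝ[X] :=
  ∑ i, C (w i) * X ^ (2 * (i : ℕ))

lemma eval_evenPoly {n : ℕ} (w : Fin (n + 1) → ℝ) (x : ℝ) :
    (evenPoly w).eval x = ∑ i, w i * x ^ (2 * (i : ℕ)) := by
  simp [evenPoly, eval_finsetSum]

lemma coeff_evenPoly {n : ℕ} (w : Fin (n + 1) → ℝ) (i : Fin (n + 1)) :
    (evenPoly w).coeff (2 * (i : ℕ)) = w i := by
  rw [evenPoly, finsetSum_coeff, Finset.sum_eq_single i]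
  · simp
  · intro j _ hj
    rw [coeff_C_mul_X_pow, if_neg]
    intro h
    exact hj (Fin.ext (by omega))
  · simp

lemma natDegree_evenPoly_le {n : ℕ} (w : Fin (n + 1) → ℝ) : (evenPoly w).natDegree ≤ 2 * n :=
  natDegree_sum_le_of_forall_le _ _ fun i _ =>
    (natDegree_C_mul_X_pow_le _ _).trans (by have := i.2; omega)

lemma exists_polynomial_expInt_shift_pow (k : ℕ) (Q : ℝ[X]) :
    ∃ P : ℝ[X], ∀ r, P.eval r = expInt 1 ((X + C r) ^ k * Q) := by
  induction k generalizing Q with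
  | zero => exact ⟨C (expInt 1 Q), fun r => by simp⟩
  | succ k ih =>
    obtain ⟨P₁, h₁⟩ := ih (X * Q)
    obtain ⟨P₂, h₂⟩ := ih Q
    refine ⟨P₁ + X * P₂, fun r => ?_⟩
    rw [eval_add, eval_mul, eval_X, h₁, h₂, ← expInt_C_mul, ← map_add]
    congr 1
    ring

/-- The linear system for the weighting has a coefficient matrix which is polynomial in `r`. -/
lemma exists_weight_matrix (n : ℕ) :
    ∃ M : Matrix (Option (Fin (n + 1))) (Option (Fin (n + 1))) ℝ[X],
      ∀ (r : ℝ) (u : Option (Fin (n + 1)) → ℝ),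
        (∀ j : Fin (n + 1), (M.map (evalRingHom r) *ᵥ u) (some j) =
          expInt 1 ((evenPoly fun i => u (some i)).comp (X + C r) *
            hasseDeriv (j : ℕ) (kernelPoly n)) -
            u none * (hasseDeriv (j : ℕ) (kernelPoly n)).eval 0) ∧
        (M.map (evalRingHom r) *ᵥ u) none = 2 * expInt 1 (X ^ (2 * n) * kernelPoly n) *
          (evenPoly fun i => u (some i)).coeff (2 * n) := by
  choose P hP using exists_polynomial_expInt_shift_pow
  refine ⟨Matrix.of fun a b => a.elim
    (b.elim 0 fun i => if i = Fin.last n then C (2 * expInt 1 (X ^ (2 * n) * kernelPoly n)) else 0)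
    (fun j => b.elim (-C ((hasseDeriv (j : ℕ) (kernelPoly n)).eval 0))
      fun i => P (2 * i) (hasseDeriv (j : ℕ) (kernelPoly n))), fun r u => ⟨fun j => ?_, ?_⟩⟩
  · simp only [Matrix.mulVec, dotProduct, Fintype.sum_option, Matrix.map_apply, Matrix.of_apply,
      Option.elim_some, Option.elim_none, coe_evalRingHom, eval_neg, eval_C, hP]
    simp only [evenPoly, Polynomial.sum_comp, mul_comp, pow_comp, C_comp, X_comp, Finset.sum_mul,
      map_sum, mul_assoc, expInt_C_mul]
    rw [Finset.sum_congr rfl fun i _ => mul_comm _ (u (some i))]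
    ring
  · have h := coeff_evenPoly (fun i => u (some i)) (Fin.last n)
    rw [Fin.val_last] at h
    simp [Matrix.mulVec, dotProduct, Fintype.sum_option, h, apply_ite (eval r)]

/-- The weighting of `[-r, r]` exists for all `r > 0` and its total mass is rational in `r`. -/
lemma exists_rational_lineWeight (n : ℕ) :
    ∃ p q : ℝ[X], (∀ r : ℝ, 0 < r → q.eval r ≠ 0) ∧ ∀ r : ℝ, 0 < r → ∃ (w : ℝ → ℝ) (c : ℝ),
      Continuous w ∧ (∀ s, w (-s) = w s) ∧
      (∀ t ∈ Icc (-r) r, inner ℝ (lineFeature n t) (lineWeight n r w c) = 1) ∧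
      ‖lineWeight n r w c‖ ^ 2 = p.eval r / q.eval r := by
  obtain ⟨M, hM⟩ := exists_weight_matrix n
  have hev : ∀ (u : Fin (n + 1) → ℝ) (x : ℝ), (evenPoly u).eval (-x) = (evenPoly u).eval x := by
    intro u x
    simp only [eval_evenPoly, (even_two_mul _).neg_pow]
  have hinner : ∀ (r : ℝ) (u : Option (Fin (n + 1)) → ℝ) (b : ℝ),
      M.map (evalRingHom r) *ᵥ u = Pi.single none b → ∀ t ∈ Icc (-r) r,
      inner ℝ (lineFeature n t)
        (lineWeight n r (fun s => (evenPoly fun i => u (some i)).eval s) (u none)) = b := by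
    intro r u b hu t ht
    rw [inner_lineFeature_lineWeight (natDegree_evenPoly_le _) (hev _) (fun j hj => ?_) ht,
      ← (hM r u).2, hu, Pi.single_eq_same]
    have := (hM r u).1 ⟨j, by omega⟩
    rw [hu, Pi.single_eq_of_ne (by simp)] at this
    linarith
  have hdet : ∀ r : ℝ, 0 < r → M.det.eval r ≠ 0 := by
    intro r hr h0
    have h1 : (M.map (evalRingHom r)).det = 0 := by
      rw [← h0, ← coe_evalRingHom, RingHom.map_det]
      rfl
    obtain ⟨v, hv, hMv⟩ := Matrix.exists_mulVec_eq_zero_iff.2 h1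
    have h2 := hinner r v 0 (by rw [hMv, Pi.single_zero])
    have h3 := norm_sq_lineWeight n hr.le _ 0 (Polynomial.continuous _) h2
    rw [mul_zero, sq_eq_zero_iff, norm_eq_zero] at h3
    obtain ⟨h4, h5⟩ := eq_zero_of_lineWeight_eq_zero hr h3
    refine hv (funext fun a => ?_)
    cases a with
    | none => exact h5
    | some i => simpa [h4] using (coeff_evenPoly (fun i => v (some i)) i).symm
  set U := M.cramer (Pi.single none 1)
  refine ⟨(∑ i : Fin (n + 1), U (some i) * (C (2 / (2 * (i : ℝ) + 1)) * X ^ (2 * (i : ℕ) + 1))) +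
    C 2 * U none, M.det, hdet, fun r hr => ?_⟩
  set u : Option (Fin (n + 1)) → ℝ := fun a => (U a).eval r / M.det.eval r with hu
  have hMu : M.map (evalRingHom r) *ᵥ u = Pi.single none 1 := by
    have h1 : M.map (evalRingHom r) *ᵥ (fun a => (U a).eval r) =
        M.det.eval r • Pi.single none 1 := by
      funext a
      have h2 := RingHom.map_mulVec (evalRingHom r) M U a
      rw [Matrix.mulVec_cramer] at h2
      rw [← Function.comp_def (eval r) U, ← coe_evalRingHom, ← h2]
      rcases eq_or_ne a none with rfl | ha
      · simp
      · simp [Pi.single_eq_of_ne ha]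
    have h3 : u = (M.det.eval r)⁻¹ • fun a => (U a).eval r := by
      funext a
      simp [hu, div_eq_inv_mul]
    rw [h3, Matrix.mulVec_smul, h1, smul_smul, inv_mul_cancel₀ (hdet r hr), one_smul]
  refine ⟨_, u none, (evenPoly fun i => u (some i)).continuous, hev _, hinner r u 1 hMu, ?_⟩
  rw [norm_sq_lineWeight n hr.le _ 1 (Polynomial.continuous _) (hinner r u 1 hMu), mul_one]
  simp only [eval_evenPoly]
  rw [intervalIntegral.integral_finsetSum fun i _ =>
    Continuous.intervalIntegrable (by fun_prop) _ _]
  simp only [intervalIntegral.integral_const_mul, integral_pow, eval_add, eval_finsetSum, eval_mul,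
    eval_C, eval_pow, eval_X, hu]
  rw [add_div, Finset.sum_div]
  congr 1
  · refine Finset.sum_congr rfl fun i _ => ?_
    rw [(odd_two_mul_add_one (i : ℕ)).neg_pow]
    push_cast
    ring
  · ring

end Rational

section SphereFeature

open MeasureTheory Set

/-- The unit sphere of `ℝ^(2n+1)`. -/
abbrev UnitSphere (n : ℕ) : Type := Metric.sphere (0 : EuclideanSpace ℝ (Fin (2 * n + 1))) 1

/-- The Hilbert space of square integrable functions on the sphere with values in `L²(ℝ)`. -/
abbrev SphereLp (n : ℕ) : Type := Lp (Lp ℝ 2 (volume : Measure ℝ)) 2 (sphereProb n)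

/-- A continuous function on the sphere as an element of `SphereLp n`. -/
noncomputable def toSphereLp (n : ℕ) (f : UnitSphere n → Lp ℝ 2 (volume : Measure ℝ))
    (hf : Continuous f) : SphereLp n :=
  (hf.memLp_of_hasCompactSupport (HasCompactSupport.of_compactSpace f)).toLp

lemma inner_toSphereLp (n : ℕ) {f : UnitSphere n → Lp ℝ 2 (volume : Measure ℝ)}
    (hf : Continuous f) (k : SphereLp n) :
    inner ℝ k (toSphereLp n f hf) = ∫ θ, inner ℝ (k θ) (f θ) ∂sphereProb n := by
  rw [L2.inner_def]
  refine integral_congr_ae ?_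
  filter_upwards [MemLp.coeFn_toLp (hf.memLp_of_hasCompactSupport (p := 2) (μ := sphereProb n)
    (HasCompactSupport.of_compactSpace f))] with θ hθ
  rw [toSphereLp, hθ]

lemma inner_toSphereLp_toSphereLp (n : ℕ) {f g : UnitSphere n → Lp ℝ 2 (volume : Measure ℝ)}
    (hf : Continuous f) (hg : Continuous g) :
    inner ℝ (toSphereLp n f hf) (toSphereLp n g hg) =
      ∫ θ, inner ℝ (f θ) (g θ) ∂sphereProb n := by
  rw [inner_toSphereLp]
  refine integral_congr_ae ?_
  filter_upwards [MemLp.coeFn_toLp (hf.memLp_of_hasCompactSupport (p := 2) (μ := sphereProb n)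
    (HasCompactSupport.of_compactSpace f))] with θ hθ
  rw [toSphereLp, hθ]

lemma continuous_lineFeature_inner (n : ℕ) (x : EuclideanSpace ℝ (Fin (2 * n + 1))) :
    Continuous fun θ : UnitSphere n =>
      lineFeature n (inner ℝ x (θ : EuclideanSpace ℝ (Fin (2 * n + 1)))) :=
  (continuous_lineFeature n).comp (by fun_prop)

/-- A feature map on `ℝ^(2n+1)` for the kernel `exp (-dist x y)`. -/
noncomputable def sphereFeature (n : ℕ) (x : EuclideanSpace ℝ (Fin (2 * n + 1))) : SphereLp n :=
  toSphereLp n _ (continuous_lineFeature_inner n x)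

lemma inner_sphereFeature (n : ℕ) (x y : EuclideanSpace ℝ (Fin (2 * n + 1))) :
    inner ℝ (sphereFeature n x) (sphereFeature n y) = Real.exp (-dist x y) := by
  rw [sphereFeature, sphereFeature, inner_toSphereLp_toSphereLp]
  simp only [inner_lineFeature, ← inner_sub_left]
  rw [integral_sphereProb_eq_radialAvg n (continuous_lineKernel n), radialAvg_lineKernel,
    dist_eq_norm]

lemma integral_integral_inner_swap (n : ℕ) (k : SphereLp n)
    {F : UnitSphere n → UnitSphere n → Lp ℝ 2 (volume : Measure ℝ)}
    (hF : Continuous (Function.uncurry F)) :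
    ∫ θ, ∫ η, inner ℝ (k θ) (F θ η) ∂sphereProb n ∂sphereProb n =
      ∫ η, ∫ θ, inner ℝ (k θ) (F θ η) ∂sphereProb n ∂sphereProb n := by
  refine integral_integral_swap ?_
  obtain ⟨B, hB⟩ := isCompact_univ.exists_bound_of_continuousOn hF.continuousOn
  have hk : Integrable (fun z : UnitSphere n × UnitSphere n => k z.1)
      ((sphereProb n).prod (sphereProb n)) :=
    ((Lp.memLp k).integrable one_le_two).comp_fst _
  refine (hk.norm.mul_const B).mono' (hk.1.inner hF.aestronglyMeasurable)
    (Filter.Eventually.of_forall fun z => ?_)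
  exact (norm_inner_le_norm _ _).trans
    (mul_le_mul_of_nonneg_left (hB z (mem_univ z)) (norm_nonneg _))

/-- The even part of the averaged trace of an element orthogonal to the features of a ball
vanishes. -/
lemma inner_integral_lineFeature_add_neg {n : ℕ} {r : ℝ} (hr : 0 < r) {k : SphereLp n}
    (hk : ∀ x ∈ Metric.closedBall (0 : EuclideanSpace ℝ (Fin (2 * n + 1))) r,
      inner ℝ k (sphereFeature n x) = 0) {s : ℝ} (hs : s ∈ Icc 0 r) :
    inner ℝ (∫ θ, k θ ∂sphereProb n) (lineFeature n s + lineFeature n (-s)) = 0 := by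
  have hcγ := continuous_lineFeature n
  have hki : Integrable k (sphereProb n) := (Lp.memLp k).integrable one_le_two
  have hmean : ∀ v, inner ℝ (∫ θ, k θ ∂sphereProb n) v = ∫ θ, inner ℝ (k θ) v ∂sphereProb n := by
    intro v
    rw [real_inner_comm, ← integral_inner hki v]
    simp only [real_inner_comm]
  set γ : ℝ → Lp ℝ 2 (volume : Measure ℝ) := fun t => lineFeature n t + lineFeature n (-t) with hγ
  have hcγ' : Continuous γ := by fun_prop
  have hγabs : ∀ t, γ |t| = γ t := by
    intro t
    rcases abs_choice t with h | h
    · rw [h]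
    · rw [h]; simp only [hγ, neg_neg]; exact add_comm _ _
  refine eq_zero_of_radialAvg_eq_zero n
    (f := fun t => inner ℝ (∫ θ, k θ ∂sphereProb n) (γ t)) (by fun_prop) hr (fun s hs => ?_) s hs
  have hradial : ∀ v (θ : UnitSphere n), radialAvg n (fun t => inner ℝ v (γ t)) s =
      ∫ η : UnitSphere n, inner ℝ v (γ (inner ℝ
        (s • (θ : EuclideanSpace ℝ (Fin (2 * n + 1)))) (η : EuclideanSpace ℝ (Fin (2 * n + 1)))))
        ∂sphereProb n := by
    intro v θ
    have h := integral_sphereProb_eq_radialAvg n (f := fun t => inner ℝ v (γ t)) (by fun_prop)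
      (s • (θ : EuclideanSpace ℝ (Fin (2 * n + 1))))
    rw [norm_smul, norm_eq_of_mem_sphere, mul_one, Real.norm_eq_abs, abs_of_nonneg hs.1] at h
    simp only [hγabs] at h
    exact h.symm
  obtain ⟨θ₀⟩ : Nonempty (UnitSphere n) := (sphereProb n).nonempty_of_neZero
  rw [hradial _ θ₀]
  simp only [hmean]
  rw [← integral_integral_inner_swap n k (F := fun _ η => γ (inner ℝ
    (s • (θ₀ : EuclideanSpace ℝ (Fin (2 * n + 1)))) (η : EuclideanSpace ℝ (Fin (2 * n + 1)))))
    (by simp only [Function.uncurry_def]; fun_prop)]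
  simp only [← hradial _ θ₀]
  have h1 : ∀ θ : UnitSphere n, radialAvg n (fun t => inner ℝ (k θ) (γ t)) s = _ :=
    fun θ => hradial (k θ) θ
  simp only [h1]
  rw [integral_integral_inner_swap n k (F := fun θ η => γ (inner ℝ
    (s • (θ : EuclideanSpace ℝ (Fin (2 * n + 1)))) (η : EuclideanSpace ℝ (Fin (2 * n + 1)))))
    (by simp only [Function.uncurry_def]; fun_prop)]
  refine integral_eq_zero_of_ae (Filter.Eventually.of_forall fun η => ?_)
  have hball : ∀ a : ℝ, |a| = s → a • (η : EuclideanSpace ℝ (Fin (2 * n + 1))) ∈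
      Metric.closedBall (0 : EuclideanSpace ℝ (Fin (2 * n + 1))) r := by
    intro a ha
    rw [mem_closedBall_zero_iff, norm_smul, norm_eq_of_mem_sphere, mul_one, Real.norm_eq_abs, ha]
    exact hs.2
  have e1 := hk _ (hball s (abs_of_nonneg hs.1))
  have e2 := hk _ (hball (-s) (by rw [abs_neg, abs_of_nonneg hs.1]))
  have e3 := inner_toSphereLp n ((continuous_lineFeature_inner n
    (s • (η : EuclideanSpace ℝ (Fin (2 * n + 1))))).add (continuous_lineFeature_inner n
    (-s • (η : EuclideanSpace ℝ (Fin (2 * n + 1)))))) k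
  have e4 : toSphereLp n _ ((continuous_lineFeature_inner n
    (s • (η : EuclideanSpace ℝ (Fin (2 * n + 1))))).add (continuous_lineFeature_inner n
    (-s • (η : EuclideanSpace ℝ (Fin (2 * n + 1)))))) =
    sphereFeature n (s • (η : EuclideanSpace ℝ (Fin (2 * n + 1)))) +
    sphereFeature n (-s • (η : EuclideanSpace ℝ (Fin (2 * n + 1)))) := rfl
  rw [e4, inner_add_right, e1, e2, add_zero] at e3
  refine (integral_congr_ae (Filter.Eventually.of_forall fun θ => ?_)).trans e3.symm
  simp only [hγ, Pi.add_apply, real_inner_smul_left, neg_mul, real_inner_comm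
    (θ : EuclideanSpace ℝ (Fin (2 * n + 1))) (η : EuclideanSpace ℝ (Fin (2 * n + 1)))]

lemma inner_lineWeight_eq_zero_of_even {n : ℕ} {r c : ℝ} (hr : 0 ≤ r) {w : ℝ → ℝ}
    (hw : Continuous w) (hev : ∀ s, w (-s) = w s) {v : Lp ℝ 2 (volume : Measure ℝ)}
    (hv : ∀ s ∈ Icc 0 r, inner ℝ v (lineFeature n s + lineFeature n (-s)) = 0) :
    inner ℝ v (lineWeight n r w c) = 0 := by
  have hcγ := continuous_lineFeature n
  rw [inner_lineWeight n r c hw, ← inner_add_right, hv r ⟨hr, le_rfl⟩, mul_zero, add_zero]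
  have h1 := intervalIntegral.integral_comp_neg (fun s => w s * inner ℝ v (lineFeature n s))
    (a := -r) (b := r)
  rw [neg_neg] at h1
  have h2 : (∫ s in -r..r, w s * inner ℝ v (lineFeature n s)) +
      ∫ s in -r..r, w (-s) * inner ℝ v (lineFeature n (-s)) = 0 := by
    rw [← intervalIntegral.integral_add (Continuous.intervalIntegrable (by fun_prop) _ _)
      (Continuous.intervalIntegrable (by fun_prop) _ _)]
    refine intervalIntegral.integral_zero_ae (Filter.Eventually.of_forall fun s hs => ?_)
    rw [uIoc_of_le (by linarith)] at hs
    rw [hev, ← mul_add, ← inner_add_right]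
    rcases le_total 0 s with h | h
    · rw [hv s ⟨h, hs.2⟩, mul_zero]
    · have := hv (-s) ⟨by linarith, by linarith [hs.1]⟩
      rw [neg_neg, add_comm] at this
      rw [this, mul_zero]
  rw [h1] at h2
  linarith

/-- A weighting on the line that is given by an even density yields the magnitude of a ball. -/
lemma setMagnitude_closedBall_eq_norm_sq_lineWeight {n : ℕ} {r c : ℝ} (hr : 0 < r) {w : ℝ → ℝ}
    (hw : Continuous w) (hev : ∀ s, w (-s) = w s)
    (hone : ∀ t ∈ Icc (-r) r, inner ℝ (lineFeature n t) (lineWeight n r w c) = 1) :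
    setMagnitude (Metric.closedBall (0 : EuclideanSpace ℝ (Fin (2 * n + 1))) r) =
      ‖lineWeight n r w c‖ ^ 2 := by
  have hh := setMagnitude_eq_norm_sq (inner_sphereFeature n)
    (linearIndependent_of_inner_eq_exp_neg_dist (inner_sphereFeature n))
    (X := Metric.closedBall (0 : EuclideanSpace ℝ (Fin (2 * n + 1))) r)
    (h := toSphereLp n (fun _ => lineWeight n r w c) continuous_const) ?_ ?_
  · rw [hh, ← real_inner_self_eq_norm_sq, inner_toSphereLp_toSphereLp]
    simp
  · intro x hx
    rw [sphereFeature, inner_toSphereLp_toSphereLp]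
    have h1 : ∀ θ : UnitSphere n, inner ℝ (lineFeature n (inner ℝ x
        (θ : EuclideanSpace ℝ (Fin (2 * n + 1))))) (lineWeight n r w c) = 1 := by
      intro θ
      refine hone _ (abs_le.1 ((abs_real_inner_le_norm _ _).trans ?_))
      rw [norm_eq_of_mem_sphere, mul_one]
      exact mem_closedBall_zero_iff.1 hx
    simp [h1]
  · rw [← Submodule.orthogonal_orthogonal_eq_closure, Submodule.mem_orthogonal]
    intro k hk
    have hk' : ∀ x ∈ Metric.closedBall (0 : EuclideanSpace ℝ (Fin (2 * n + 1))) r,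
        inner ℝ k (sphereFeature n x) = 0 := fun x hx =>
      Submodule.inner_left_of_mem_orthogonal (Submodule.subset_span (mem_image_of_mem _ hx)) hk
    have h1 := inner_lineWeight_eq_zero_of_even (n := n) (c := c) hr.le hw hev
      fun s hs => inner_integral_lineFeature_add_neg hr hk' hs
    rw [inner_toSphereLp, ← h1, real_inner_comm, ← integral_inner
      ((Lp.memLp k).integrable one_le_two)]
    simp only [real_inner_comm]

end SphereFeature

/-- For every nonnegative integer n, the magnitude of the closed ball of
radius r in ℝ^{2n+1} is a rational function of r for r > 0. -/
theorem magnitude_ball_rational (n : ℕ) :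
    ∃ p q : Polynomial ℝ, (∀ r : ℝ, 0 < r → Polynomial.eval r q ≠ 0) ∧
      ∀ r : ℝ, 0 < r →
        setMagnitude (Metric.closedBall (0 : EuclideanSpace ℝ (Fin (2 * n + 1))) r) =
          Polynomial.eval r p / Polynomial.eval r q := by
  obtain ⟨p, q, hq, h⟩ := exists_rational_lineWeight n
  refine ⟨p, q, hq, fun r hr => ?_⟩
  obtain ⟨w, c, hw, hev, hone, hnorm⟩ := h r hr
  rw [setMagnitude_closedBall_eq_norm_sq_lineWeight hr hw hev hone, hnorm]
end
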